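/- For every real λ with 2 ≤ λ < λ* there exists N ∈ ℕ such that every connected signed graph G^± satisfying −λ ≤ λ₁(G^±) < −2 has at most N vertices; equivalently, up to isomorphism there are only finitely many connected signed graphs whose smallest eigenvalue lies in the interval [−λ, −2). -/

import Mathlib

open Classical

/-- An eigenvalue of a real matrix indexed by a finite type. -/
def IsEigenvalue {V : Type*} [Fintype V] (A : Matrix V V ℝ) (μ : ℝ) : Prop :=
  ∃ v : V → ℝ, v ≠ 0 ∧ A.mulVec v = μ • v

/-- The smallest eigenvalue of a real matrix. -/
noncomputable def minEig {V : Type*} [Fintype V] (A : Matrix V V ℝ) : ℝ :=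
  sInf {μ : ℝ | IsEigenvalue A μ}

/-- A signed graph on `n` vertices, given by its signed adjacency matrix: a symmetric real
matrix with zero diagonal and off-diagonal entries in `{-1, 0, 1}`. -/
structure SignedGraph (n : ℕ) where
  mat : Matrix (Fin n) (Fin n) ℝ
  isSymm : mat.IsSymm
  diag_zero : ∀ i, mat i i = 0
  entries : ∀ i j, mat i j = -1 ∨ mat i j = 0 ∨ mat i j = 1

/-- The underlying simple graph of a signed graph, with an edge at each nonzero entry. -/
def SignedGraph.toSimple {n : ℕ} (G : SignedGraph n) : SimpleGraph (Fin n) :=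
  SimpleGraph.fromRel fun i j => G.mat i j ≠ 0

open scoped Matrix

/-- Conductance tail: a path carrying zero charge costs at least `κ` times the squared potential
at its first vertex, up to the potential left at its last vertex. -/
theorem path_tail_energy_ge (κ : ℝ) (g : ℕ → ℝ) (j k : ℕ) :
    κ * (g j ^ 2 - g (j + k) ^ 2) ≤
      ∑ i ∈ Finset.range k, g (j + i + 1) ^ 2 +
        (κ * (κ + 1)) * ∑ i ∈ Finset.range k, (g (j + i) - g (j + i + 1)) ^ 2 := by
  induction k with
  | zero => simp
  | succ k ih =>
    rw [Finset.sum_range_succ, Finset.sum_range_succ]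
    have h := sq_nonneg (κ * g (j + k) - (κ + 1) * g (j + k + 1))
    rw [show j + (k + 1) = j + k + 1 by ring]
    nlinarith

/-- Two springs in series. -/
theorem series_sq_le {a b : ℝ} (ha : 0 < a) (hb : 0 < b) (x y : ℝ) :
    a * b / (a + b) * (x + y) ^ 2 ≤ a * x ^ 2 + b * y ^ 2 := by
  rw [div_mul_eq_mul_div, div_le_iff₀ (by positivity)]
  nlinarith [sq_nonneg (a * x - b * y)]

/-- Energy of a potential `g` on a path with `n` vertices relative to the charge `c`. -/
noncomputable def pathEnergy (r : ℝ) (n : ℕ) (c g : ℕ → ℝ) : ℝ :=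
  ∑ i ∈ Finset.range n, (c i - g i) ^ 2 +
    r * ∑ i ∈ Finset.range (n - 1), (g i - g (i + 1)) ^ 2

theorem pathEnergy_two_ge {t κ : ℝ} (ht : 1 < t) (hκ : κ = 1 / (t - 1)) (k : ℕ)
    (c g : ℕ → ℝ) (h1 : ∀ i < 2, c i = 1) (h0 : ∀ i, 2 ≤ i → i < 2 + k → c i = 0) :
    (t ^ 2 + 1) / t ^ 3 - κ * g (k + 1) ^ 2 ≤ pathEnergy (κ * (κ + 1)) (2 + k) c g := by
  have htail := path_tail_energy_ge κ g 1 k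
  have hκ0 : 0 < κ := by rw [hκ]; exact one_div_pos.2 (by linarith)
  have ht' : t = (κ + 1) / κ := by
    have : t - 1 ≠ 0 := by linarith
    rw [hκ]; field_simp; ring
  have e1 := series_sq_le one_pos (show 0 < κ * (κ + 1) by positivity) (1 - g 0) (g 0 - g 1)
  set a : ℝ := 1 + 1 * (κ * (κ + 1)) / (1 + κ * (κ + 1)) with ha
  have ha0 : 0 < a := by positivity
  have e2 := series_sq_le ha0 hκ0 (1 - g 1) (g 1)
  have e3 : a * κ / (a + κ) = (t ^ 2 + 1) / t ^ 3 := by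
    rw [ha, ht']; field_simp; ring
  rw [e3] at e2
  have e4 : pathEnergy (κ * (κ + 1)) (2 + k) c g = (1 - g 0) ^ 2 + (1 - g 1) ^ 2 +
      κ * (κ + 1) * (g 0 - g 1) ^ 2 + (∑ i ∈ Finset.range k, g (1 + i + 1) ^ 2 +
        (κ * (κ + 1)) * ∑ i ∈ Finset.range k, (g (1 + i) - g (1 + i + 1)) ^ 2) := by
    unfold pathEnergy
    rw [show 2 + k - 1 = 1 + k by omega, Finset.sum_range_add, Finset.sum_range_add,
      Finset.sum_congr (s₁ := Finset.range k) (g := fun i => g (1 + i + 1) ^ 2) rfl]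
    · simp only [Finset.sum_range_succ, Finset.sum_range_zero, h1 0 (by norm_num),
        h1 1 (by norm_num)]
      ring
    · intro i hi
      rw [h0 _ (by omega) (by simpa using hi), show 2 + i = 1 + i + 1 by omega]; ring
  rw [e4, show k + 1 = 1 + k by omega]
  simp only [sub_add_sub_cancel, sub_add_cancel, one_pow, mul_one] at e1 e2
  have e5 : 1 * (κ * (κ + 1)) / (1 + κ * (κ + 1)) * (1 - g 1) ^ 2 = (a - 1) * (1 - g 1) ^ 2 := by
    rw [ha]; ring
  nlinarith

theorem pathEnergy_three_ge {t κ : ℝ} (ht : 1 < t) (hκ : κ = 1 / (t - 1)) (p k : ℕ)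
    (c g : ℕ → ℝ) (h1 : ∀ i < p + 3, c i = 1) (h0 : ∀ i, p + 3 ≤ i → i < p + 3 + k → c i = 0) :
    (t ^ 4 + t ^ 2 + 1) / t ^ 5 - κ * g (p + k + 2) ^ 2 ≤
      pathEnergy (κ * (κ + 1)) (p + 3 + k) c g := by
  have htail := path_tail_energy_ge κ g (p + 2) k
  have hκ0 : 0 < κ := by rw [hκ]; exact one_div_pos.2 (by linarith)
  have ht' : t = (κ + 1) / κ := by
    have : t - 1 ≠ 0 := by linarith
    rw [hκ]; field_simp; ring
  have hr : 0 < κ * (κ + 1) := by positivity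
  have e1 := series_sq_le one_pos hr (1 - g p) (g p - g (p + 1))
  set a : ℝ := 1 + 1 * (κ * (κ + 1)) / (1 + κ * (κ + 1)) with ha
  have ha0 : 0 < a := by positivity
  have e2 := series_sq_le ha0 hr (1 - g (p + 1)) (g (p + 1) - g (p + 2))
  set b : ℝ := 1 + a * (κ * (κ + 1)) / (a + κ * (κ + 1)) with hb
  have hb0 : 0 < b := by positivity
  have e3 := series_sq_le hb0 hκ0 (1 - g (p + 2)) (g (p + 2))
  have e4 : b * κ / (b + κ) = (t ^ 4 + t ^ 2 + 1) / t ^ 5 := by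
    rw [hb, ha, ht']; field_simp; ring
  rw [e4] at e3
  have e5 : (1 - g p) ^ 2 + (1 - g (p + 1)) ^ 2 + (1 - g (p + 2)) ^ 2 +
      κ * (κ + 1) * ((g p - g (p + 1)) ^ 2 + (g (p + 1) - g (p + 2)) ^ 2) +
      (∑ i ∈ Finset.range k, g (p + 2 + i + 1) ^ 2 +
        (κ * (κ + 1)) * ∑ i ∈ Finset.range k, (g (p + 2 + i) - g (p + 2 + i + 1)) ^ 2) ≤
        pathEnergy (κ * (κ + 1)) (p + 3 + k) c g := by
    unfold pathEnergy
    rw [show p + 3 + k - 1 = p + 2 + k by omega, Finset.sum_range_add _ (p + 3) k,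
      Finset.sum_range_add _ (p + 2) k,
      Finset.sum_congr (s₁ := Finset.range k) (f := fun x => (c (p + 3 + x) - g (p + 3 + x)) ^ 2)
        (g := fun i => g (p + 2 + i + 1) ^ 2) rfl]
    · simp only [Finset.sum_range_succ, h1 p (by omega), h1 (p + 1) (by omega),
        h1 (p + 2) (by omega)]
      have q1 : 0 ≤ ∑ i ∈ Finset.range p, (c i - g i) ^ 2 :=
        Finset.sum_nonneg fun _ _ => sq_nonneg _
      have q2 : 0 ≤ κ * (κ + 1) * ∑ i ∈ Finset.range p, (g i - g (i + 1)) ^ 2 :=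
        mul_nonneg hr.le (Finset.sum_nonneg fun _ _ => sq_nonneg _)
      rw [show p + 1 + 1 = p + 2 by ring]
      nlinarith
    · intro i hi
      rw [h0 _ (by omega) (by simpa using hi), show p + 3 + i = p + 2 + i + 1 by omega]; ring
  refine le_trans ?_ e5
  rw [show p + k + 2 = p + 2 + k by omega]
  simp only [sub_add_sub_cancel, sub_add_cancel, one_pow, mul_one] at e1 e2 e3
  have e6 : 1 * (κ * (κ + 1)) / (1 + κ * (κ + 1)) * (1 - g (p + 1)) ^ 2 =
      (a - 1) * (1 - g (p + 1)) ^ 2 := by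
    rw [ha]; ring
  have e7 : a * (κ * (κ + 1)) / (a + κ * (κ + 1)) * (1 - g (p + 2)) ^ 2 =
      (b - 1) * (1 - g (p + 2)) ^ 2 := by
    rw [hb]; ring
  nlinarith

theorem sum_sq_gaps_le {g : ℕ → ℝ} {i j : ℕ} (hij : i ≤ j)
    (hg : ∀ l, i ≤ l → l < j → g (l + 1) ≤ g l) :
    ∑ l ∈ Finset.Ico i j, (g l - g (l + 1)) ^ 2 ≤ (g i - g j) ^ 2 ∧ g j ≤ g i := by
  induction j, hij using Nat.le_induction with
  | base => simp
  | succ j hij ih =>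
    obtain ⟨h1, h2⟩ := ih fun l hl hl' => hg l hl (by omega)
    have h3 := hg j hij (by omega)
    rw [Finset.sum_Ico_succ_top hij]
    exact ⟨by nlinarith, by linarith⟩

/-- An enumeration of a finite type along which a real function is decreasing. -/
theorem exists_antitone_enumeration {V : Type*} [Fintype V] (h : V → ℝ) :
    ∃ e : Fin (Fintype.card V) ≃ V, Antitone (h ∘ e) := by
  let e0 := (Fintype.equivFin V).symm
  refine ⟨(Tuple.sort (fun i => -h (e0 i))).trans e0, ?_⟩
  intro i j hij
  have := Tuple.monotone_sort (fun i => -h (e0 i)) hij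
  simpa using this

/-- Extension by zero of the values of `h` along an enumeration. -/
noncomputable def valuesAlong {V : Type*} {n : ℕ} (e : Fin n ≃ V) (h : V → ℝ) (i : ℕ) : ℝ :=
  if hi : i < n then h (e ⟨i, hi⟩) else 0

/-- Pairs `(a k, b k)` joining every nonempty proper subset of `V` to its complement. -/
def CrossesCuts {V ι : Type*} (a b : ι → V) : Prop :=
  ∀ S : Set V, S.Nonempty → Sᶜ.Nonempty →
    ∃ k, (a k ∈ S ∧ b k ∉ S) ∨ (b k ∈ S ∧ a k ∉ S)

/-- Decreasing rearrangement onto a path does not increase the Dirichlet energy. -/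
theorem sum_sq_gaps_le_dirichlet {V ι : Type*} [Fintype V] [Fintype ι] {a b : ι → V}
    (hcut : CrossesCuts a b) (h : V → ℝ) {n : ℕ} (e : Fin n ≃ V) (he : Antitone (h ∘ e)) :
    ∑ l ∈ Finset.range (n - 1), (valuesAlong e h l - valuesAlong e h (l + 1)) ^ 2 ≤
      ∑ k, (h (a k) - h (b k)) ^ 2 := by
  set g := valuesAlong e h with hg
  have hanti : ∀ l, l + 1 < n → g (l + 1) ≤ g l := by
    intro l hl
    simp only [hg, valuesAlong, hl, (by omega : l < n), dif_pos]
    exact he (by simp [Fin.le_def])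
  let lo : ι → ℕ := fun k => min (e.symm (a k) : ℕ) (e.symm (b k))
  let hi : ι → ℕ := fun k => max (e.symm (a k) : ℕ) (e.symm (b k))
  have hval : ∀ v, g (e.symm v) = h v := fun v => by simp [hg, valuesAlong]
  calc ∑ l ∈ Finset.range (n - 1), (g l - g (l + 1)) ^ 2
      ≤ ∑ l ∈ Finset.range (n - 1), ∑ k, if l ∈ Finset.Ico (lo k) (hi k)
          then (g l - g (l + 1)) ^ 2 else 0 := by
        refine Finset.sum_le_sum fun l hl => ?_
        have hl' : l + 1 < n := by have := Finset.mem_range.1 hl; omega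
        obtain ⟨k, hk⟩ := hcut {v | (e.symm v : ℕ) ≤ l} ⟨e ⟨l, by omega⟩, by simp⟩
          ⟨e ⟨l + 1, hl'⟩, by simp⟩
        have hmem : l ∈ Finset.Ico (lo k) (hi k) := by
          simp only [Set.mem_ofPred_eq] at hk
          simp only [lo, hi, Finset.mem_Ico]
          omega
        refine le_trans (le_of_eq ?_) (Finset.single_le_sum (f := fun k =>
          if l ∈ Finset.Ico (lo k) (hi k) then (g l - g (l + 1)) ^ 2 else 0)
          (fun k _ => ?_) (Finset.mem_univ k))
        · simp only [hmem, if_true]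
        · split_ifs <;> positivity
    _ = ∑ k, ∑ l ∈ Finset.range (n - 1), if l ∈ Finset.Ico (lo k) (hi k)
          then (g l - g (l + 1)) ^ 2 else 0 := Finset.sum_comm
    _ ≤ ∑ k, (h (a k) - h (b k)) ^ 2 := by
        refine Finset.sum_le_sum fun k _ => ?_
        have hk1 : hi k < n := by simp [hi]
        rw [← Finset.sum_filter]
        have hsub : (Finset.range (n - 1)).filter (fun l => l ∈ Finset.Ico (lo k) (hi k)) =
            Finset.Ico (lo k) (hi k) := by
          ext l; simp only [Finset.mem_filter, Finset.mem_range, Finset.mem_Ico]; omega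
        rw [hsub]
        refine (sum_sq_gaps_le (by simp [lo, hi]) fun l _ hl => hanti l (by omega)).1.trans ?_
        rw [← hval (a k), ← hval (b k)]
        rcases le_total (e.symm (a k) : ℕ) (e.symm (b k)) with hab | hab
        · simp only [lo, hi, min_eq_left hab, max_eq_right hab, le_refl]
        · simp only [lo, hi, min_eq_right hab, max_eq_left hab]
          exact le_of_eq (by ring)

/-- Rearrangement inequality: sorting both functions decreases their squared distance. -/
theorem sum_sq_sub_sorted_le {V : Type*} [Fintype V] (c h : V → ℝ) {n : ℕ} (e e' : Fin n ≃ V)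
    (he : Antitone (h ∘ e)) (he' : Antitone (c ∘ e')) :
    ∑ i, (c (e' i) - h (e i)) ^ 2 ≤ ∑ v, (c v - h v) ^ 2 := by
  have h1 : ∑ v, c v * h v ≤ ∑ i, c (e' i) * h (e i) := by
    have hm : Monovary (c ∘ e') (h ∘ e) := he'.monovary he
    have := hm.sum_mul_comp_perm_le_sum_mul (σ := e'.trans e.symm)
    simp only [Function.comp_apply, Equiv.trans_apply, Equiv.apply_symm_apply] at this
    rwa [Equiv.sum_comp e' (fun v => c v * h v)] at this
  have h2 := Equiv.sum_comp e' (fun v => c v ^ 2)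
  have h3 := Equiv.sum_comp e (fun v => h v ^ 2)
  have h4 : ∀ (ι : Type _) [Fintype ι] (x y : ι → ℝ), ∑ i, (x i - y i) ^ 2 =
      ∑ i, x i ^ 2 + ∑ i, y i ^ 2 - 2 * ∑ i, x i * y i := by
    intro ι _ x y
    rw [Finset.mul_sum, ← Finset.sum_add_distrib, ← Finset.sum_sub_distrib]
    exact Finset.sum_congr rfl fun _ _ => by ring
  have h5 := h4 (Fin n) (fun i => c (e' i)) (fun i => h (e i))
  have h6 : ∑ v, (c v - h v) ^ 2 = ∑ i, c i ^ 2 + ∑ i, h i ^ 2 - 2 * ∑ i, c i * h i := by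
    rw [Finset.mul_sum, ← Finset.sum_add_distrib, ← Finset.sum_sub_distrib]
    exact Finset.sum_congr rfl fun _ _ => by ring
  linarith

/-- Energy of a potential `h` on the graph with edges `a k — b k`, relative to a charge `c`. -/
noncomputable def energy {V ι : Type*} [Fintype V] [Fintype ι] (r : ℝ) (a b : ι → V)
    (c h : V → ℝ) : ℝ :=
  ∑ v, (c v - h v) ^ 2 + r * ∑ k, (h (a k) - h (b k)) ^ 2

theorem energy_comp_le {V ι : Type*} [Fintype V] [Fintype ι] {r : ℝ} (hr : 0 ≤ r) (a b : ι → V)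
    (c h : V → ℝ) {η : ℝ → ℝ} (hη : ∀ x y, |η x - η y| ≤ |x - y|) :
    energy r a b (fun v => η (c v)) (fun v => η (h v)) ≤ energy r a b c h :=
  add_le_add (Finset.sum_le_sum fun _ _ => sq_le_sq.2 (hη _ _))
    (mul_le_mul_of_nonneg_left (Finset.sum_le_sum fun _ _ => sq_le_sq.2 (hη _ _)) hr)

/-- The indicator function of a finite set. -/
noncomputable def finsetIndicator {V : Type*} (T : Finset V) (v : V) : ℝ := if v ∈ T then 1 else 0

theorem exists_enumeration_finset {V : Type*} [Fintype V] (T : Finset V) :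
    ∃ e : Fin (Fintype.card V) ≃ V, Antitone (finsetIndicator T ∘ e) ∧
      ∀ i, e i ∈ T ↔ (i : ℕ) < T.card := by
  obtain ⟨e, he⟩ := exists_antitone_enumeration (finsetIndicator T)
  have hmono : ∀ i j, i ≤ j → e j ∈ T → e i ∈ T := by
    intro i j hij hj
    by_contra hi
    have := he hij
    simp only [Function.comp_apply, finsetIndicator, hj, hi, if_true, if_false] at this
    linarith
  refine ⟨e, he, fun i => ⟨fun hi => ?_, fun hi => ?_⟩⟩
  · have hsub : (Finset.Iic i).map e.toEmbedding ⊆ T := by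
      intro v hv
      obtain ⟨j, hj, rfl⟩ := Finset.mem_map.1 hv
      exact hmono _ _ (Finset.mem_Iic.1 hj) hi
    have := Finset.card_le_card hsub
    rw [Finset.card_map, Fin.card_Iic] at this
    omega
  · by_contra hc
    have hsub : T ⊆ (Finset.Iio i).map e.toEmbedding := by
      intro v hv
      refine Finset.mem_map.2 ⟨e.symm v, Finset.mem_Iio.2 ?_, by simp⟩
      by_contra hlt
      exact hc (hmono _ _ (not_lt.1 hlt) (by simpa using hv))
    have := Finset.card_le_card hsub
    rw [Finset.card_map, Fin.card_Iio] at this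
    omega

/-- A bound for energies on paths transfers to indicator functions on connected graphs. -/
theorem le_energy_finsetIndicator {V ι : Type*} [Fintype V] [Fintype ι] {r κ v : ℝ} (hr : 0 ≤ r)
    (hκ : 0 ≤ κ) {a b : ι → V} (hcut : CrossesCuts a b) (T : Finset V)
    (hT : 2 * T.card ≤ Fintype.card V) (hV : 0 < Fintype.card V)
    (hpath : ∀ c g : ℕ → ℝ, (∀ i < T.card, c i = 1) →
      (∀ i, T.card ≤ i → i < Fintype.card V → c i = 0) →
      v - κ * g (Fintype.card V - 1) ^ 2 ≤ pathEnergy r (Fintype.card V) c g) (h : V → ℝ) :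
    v ≤ (1 + 2 * κ / Fintype.card V) * energy r a b (finsetIndicator T) h := by
  set n := Fintype.card V with hn
  obtain ⟨e', he', hmem⟩ := exists_enumeration_finset T
  obtain ⟨e, he⟩ := exists_antitone_enumeration (fun v => |h v|)
  set c := valuesAlong e' (finsetIndicator T) with hc
  set g := valuesAlong e (fun v => |h v|) with hg
  have hc1 : ∀ i < T.card, c i = 1 := by
    intro i hi
    have hin : i < n := by omega
    have := (hmem ⟨i, hin⟩).2 hi
    simp [hc, valuesAlong, finsetIndicator, ← hn, hin, this]
  have hc0 : ∀ i, T.card ≤ i → i < n → c i = 0 := by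
    intro i hi hin
    have := (not_congr (hmem ⟨i, hin⟩)).2 (not_lt.2 hi)
    simp [hc, valuesAlong, finsetIndicator, ← hn, hin, this]
  have hP : pathEnergy r n c g ≤ energy r a b (finsetIndicator T) h := by
    have h1 := sum_sq_gaps_le_dirichlet hcut _ e he
    have h2 := sum_sq_sub_sorted_le (finsetIndicator T) _ e e' he he'
    have h3 : ∑ i ∈ Finset.range n, (c i - g i) ^ 2 =
        ∑ i, (finsetIndicator T (e' i) - |h (e i)|) ^ 2 := by
      rw [← Fin.sum_univ_eq_sum_range (fun i => (c i - g i) ^ 2)]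
      exact Finset.sum_congr rfl fun i _ => by simp [hc, hg, valuesAlong, ← hn]
    unfold pathEnergy
    rw [h3]
    refine (add_le_add h2 (mul_le_mul_of_nonneg_left h1 hr)).trans ?_
    refine add_le_add (Finset.sum_le_sum fun v _ => ?_) (mul_le_mul_of_nonneg_left
      (Finset.sum_le_sum fun k _ => sq_le_sq.2 (abs_abs_sub_abs_le_abs_sub _ _)) hr)
    unfold finsetIndicator
    split_ifs
    · nlinarith [sq_abs (h v), le_abs_self (h v)]
    · simp
  have htail : (n / 2 : ℝ) * g (n - 1) ^ 2 ≤ pathEnergy r n c g := by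
    have hgl : ∀ i < n, g (n - 1) ^ 2 ≤ g i ^ 2 := by
      intro i hi
      have h1 : g (n - 1) ≤ g i := by
        simp only [hg, valuesAlong, ← hn, hi, show n - 1 < n by omega, dif_pos]
        exact he (by rw [Fin.le_def]; dsimp only; omega)
      have h2 : 0 ≤ g (n - 1) := by
        simp only [hg, valuesAlong, ← hn, show n - 1 < n by omega, dif_pos]
        exact abs_nonneg _
      exact pow_le_pow_left₀ h2 h1 2
    have h1 : ∑ i ∈ Finset.Ico T.card n, g (n - 1) ^ 2 ≤
        ∑ i ∈ Finset.range n, (c i - g i) ^ 2 := by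
      refine le_trans (Finset.sum_le_sum (g := fun i => (c i - g i) ^ 2) fun i hi => ?_)
        (Finset.sum_le_sum_of_subset_of_nonneg (fun i hi => ?_) fun _ _ _ => sq_nonneg _)
      · obtain ⟨hi1, hi2⟩ := Finset.mem_Ico.1 hi
        rw [hc0 i hi1 hi2, zero_sub, neg_sq]
        exact hgl i hi2
      · exact Finset.mem_range.2 (Finset.mem_Ico.1 hi).2
    rw [Finset.sum_const, Nat.card_Ico, nsmul_eq_mul, Nat.cast_sub (by omega)] at h1
    have h2 : (2 * T.card : ℝ) ≤ n := by exact_mod_cast hT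
    have h3 : 0 ≤ r * ∑ i ∈ Finset.range (n - 1), (g i - g (i + 1)) ^ 2 :=
      mul_nonneg hr (Finset.sum_nonneg fun _ _ => sq_nonneg _)
    unfold pathEnergy
    nlinarith [sq_nonneg (g (n - 1))]
  have hfin := hpath c g hc1 hc0
  have hn0 : (0 : ℝ) < n := by exact_mod_cast hV
  have h5 : κ * g (n - 1) ^ 2 ≤ 2 * κ / n * pathEnergy r n c g := by
    have := mul_le_mul_of_nonneg_left htail (show 0 ≤ 2 * κ / n by positivity)
    refine le_trans (le_of_eq ?_) this
    field_simp
  have h6 : 0 ≤ 1 + 2 * κ / n := by positivity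
  nlinarith [mul_le_mul_of_nonneg_left hP h6]

/-- Energies of indicator functions exceed what a smallest eigenvalue at least `-lam` allows. -/
def IsStiff {V ι : Type*} [Fintype V] [Fintype ι] (r lam : ℝ) (a b : ι → V) : Prop :=
  (∀ (T : Finset V) (h : V → ℝ), T.card = 2 →
    lam - 1 / lam < energy r a b (finsetIndicator T) h) ∧
  ∀ (T : Finset V) (h : V → ℝ), 3 ≤ T.card → T.card + 3 ≤ Fintype.card V →
    lam < energy r a b (finsetIndicator T) h

theorem exists_isStiff_of_card_ge {t lamStar lam : ℝ} (ht : 1 < t) (ht6 : t ^ 6 = t ^ 2 + 1)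
    (hstar : lamStar = t + t⁻¹) (h2 : 2 ≤ lam) (hlt : lam < lamStar) :
    ∃ N : ℕ, ∀ {V ι : Type} [Fintype V] [Fintype ι] (a b : ι → V), CrossesCuts a b →
      N ≤ Fintype.card V → IsStiff (1 / (lamStar - 2)) lam a b := by
  set κ := 1 / (t - 1) with hκ
  have ht1 : 0 < t - 1 := by linarith
  have ht0 : 0 < t := by linarith
  have hκ0 : 0 < κ := by positivity
  have hr : 1 / (lamStar - 2) = κ * (κ + 1) := by
    have h1 : lamStar - 2 = (t - 1) ^ 2 / t := by rw [hstar]; field_simp; ring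
    rw [h1, hκ]; field_simp; ring
  have hv3 : (t ^ 4 + t ^ 2 + 1) / t ^ 5 = lamStar := by
    rw [hstar]; field_simp; linear_combination -ht6
  have hv2 : (t ^ 2 + 1) / t ^ 3 = lamStar - 1 / lamStar := by
    have h1 : lamStar = t ^ 5 := by rw [hstar]; field_simp; linear_combination -ht6
    rw [h1, ← ht6]
    field_simp
    linear_combination ht6 * (t ^ 2 - t ^ 4 - 1)
  have hl0 : 0 < lam := by linarith
  have hgap : lam - 1 / lam < lamStar - 1 / lamStar := by
    have := one_div_lt_one_div_of_lt hl0 hlt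
    linarith
  have hl1 : 0 < lam - 1 / lam := by
    have : 1 / lam ≤ 1 / 2 := one_div_le_one_div_of_le (by norm_num) h2
    linarith
  have hlim : Filter.Tendsto (fun n : ℕ => 1 + 2 * κ / (n : ℝ)) Filter.atTop (nhds 1) := by
    have := (tendsto_const_div_atTop_nhds_zero_nat (2 * κ)).const_add 1
    simpa using this
  have e1 := (hlim.mul_const lam).eventually_lt_const (by rwa [one_mul])
  have e2 := (hlim.mul_const (lam - 1 / lam)).eventually_lt_const (by rwa [one_mul])
  obtain ⟨N, hN⟩ := Filter.eventually_atTop.1 (e1.and e2)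
  refine ⟨max N 6, fun {V ι} _ _ a b hcut hV => ?_⟩
  obtain ⟨h3, h4⟩ := hN _ (le_trans (le_max_left _ _) hV)
  have hV6 := le_trans (le_max_right _ _) hV
  rw [hr]
  have hr0 : 0 ≤ κ * (κ + 1) := by positivity
  have hfac : 0 < 1 + 2 * κ / (Fintype.card V : ℝ) := by positivity
  have half : ∀ (T : Finset V) (h : V → ℝ), 3 ≤ T.card → 2 * T.card ≤ Fintype.card V →
      lam < energy (κ * (κ + 1)) a b (finsetIndicator T) h := by
    intro T h hT hT'
    have := le_energy_finsetIndicator (v := lamStar) hr0 hκ0.le hcut T hT' (by omega)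
      (fun c g hc1 hc0 => by
        have := pathEnergy_three_ge ht hκ (T.card - 3) (Fintype.card V - T.card) c g
          (fun i hi => hc1 i (by omega)) (fun i hi hi' => hc0 i (by omega) (by omega))
        rwa [hv3, show T.card - 3 + 3 + (Fintype.card V - T.card) = Fintype.card V by omega,
          show T.card - 3 + (Fintype.card V - T.card) + 2 = Fintype.card V - 1 by omega] at this) h
    exact lt_of_mul_lt_mul_left (h3.trans_le this) hfac.le
  refine ⟨fun T h hT => ?_, fun T h hT hT' => ?_⟩
  · have := le_energy_finsetIndicator (v := lamStar - 1 / lamStar) hr0 hκ0.le hcut T (by omega)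
      (by omega) (fun c g hc1 hc0 => by
        have := pathEnergy_two_ge ht hκ (Fintype.card V - 2) c g
          (fun i hi => hc1 i (by omega)) (fun i hi hi' => hc0 i (by omega) (by omega))
        rwa [hv2, show 2 + (Fintype.card V - 2) = Fintype.card V by omega,
          show Fintype.card V - 2 + 1 = Fintype.card V - 1 by omega] at this) h
    exact lt_of_mul_lt_mul_left (h4.trans_le this) hfac.le
  · rcases le_or_gt (2 * T.card) (Fintype.card V) with hc | hc
    · exact half T h hT hc
    · have h5 := half Tᶜ (fun v => 1 - h v) (by rw [Finset.card_compl]; omega)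
        (by rw [Finset.card_compl]; omega)
      refine h5.trans_le ((le_of_eq ?_).trans
        (energy_comp_le hr0 a b _ _ (η := fun x => 1 - x) fun x y => ?_))
      · congr 1
        ext v
        by_cases hv : v ∈ T <;> simp [finsetIndicator, hv]
      · rw [sub_sub_sub_cancel_left, abs_sub_comm]

theorem sum_finsetIndicator {V : Type*} [Fintype V] (T : Finset V) :
    ∑ v, finsetIndicator T v = T.card := by
  simp [finsetIndicator]

/-- A charge bounded by `2` of total mass at most `4` has energy exceeding its squared norm by
more than `2 * lam - 6`. -/
theorem IsStiff.lt_energy_of_sum_abs_le {V ι : Type*} [Fintype V] [Fintype ι] {r lam : ℝ}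
    {a b : ι → V} (hst : IsStiff r lam a b) (hr : 0 ≤ r) (hlam : 2 ≤ lam)
    (hV : 2 ≤ Fintype.card V) (C h : V → ℝ) (hC : ∀ v, |C v| ≤ 2) (hsum : ∑ v, |C v| ≤ 4) :
    ∑ v, C v ^ 2 - 6 + 2 * lam < energy r a b C h := by
  have : Nonempty V := Fintype.card_pos_iff.1 (by omega)
  obtain ⟨p, -, hp⟩ := Finset.exists_max_image Finset.univ (fun v => |h v|) Finset.univ_nonempty
  obtain ⟨q, hq, hq'⟩ := Finset.exists_max_image (Finset.univ.erase p) (fun v => |h v|)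
    (Finset.card_pos.1 (by rw [Finset.card_erase_of_mem (Finset.mem_univ p), Finset.card_univ]
                           omega))
  have hpq : p ≠ q := (Finset.ne_of_mem_erase hq).symm
  set T : Finset V := {p, q} with hT
  have hTc : T.card = 2 := Finset.card_pair hpq
  have h2 := hst.1 T (fun v => |h v| / 2) hTc
  have h3 : 2 + 2 * lam ≤ 4 * (lam - 1 / lam) := by
    have : lam * (1 / lam) = 1 := by field_simp
    have h4 : 1 / lam ≤ 1 / 2 := one_div_le_one_div_of_le (by norm_num) hlam
    linarith
  set m := |h q| with hm
  have hpt : ∀ v, C v ^ 2 + 4 * (finsetIndicator T v - |h v| / 2) ^ 2 +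
      (4 * m - 4) * finsetIndicator T v - 2 * m * |C v| ≤ (C v - h v) ^ 2 := by
    intro v
    have e1 : C v * h v ≤ |C v| * |h v| := (le_abs_self _).trans (abs_mul _ _).le
    have e2 := sq_abs (h v)
    have e3 := hC v
    have e4 := abs_nonneg (C v)
    unfold finsetIndicator
    by_cases hv : v ∈ T
    · have hmv : m ≤ |h v| := by
        rcases Finset.mem_insert.1 hv with rfl | hv
        · exact hp q (Finset.mem_univ _)
        · rw [Finset.mem_singleton.1 hv]
      simp only [hv, if_true]
      nlinarith
    · have hmv : |h v| ≤ m := hq' v (Finset.mem_erase.2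
        ⟨fun hvp => hv (by simp [hT, hvp]), Finset.mem_univ _⟩)
      simp only [hv, if_false]
      nlinarith
  have hsum2 := Finset.sum_le_sum fun v (_ : v ∈ Finset.univ) => hpt v
  rw [Finset.sum_sub_distrib, Finset.sum_add_distrib, Finset.sum_add_distrib, ← Finset.mul_sum,
    ← Finset.mul_sum, ← Finset.mul_sum, sum_finsetIndicator, hTc] at hsum2
  have hD : 4 * (r * ∑ k, (|h (a k)| / 2 - |h (b k)| / 2) ^ 2) ≤
      r * ∑ k, (h (a k) - h (b k)) ^ 2 := by
    rw [mul_left_comm, Finset.mul_sum]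
    refine mul_le_mul_of_nonneg_left (Finset.sum_le_sum fun k _ => ?_) hr
    have := sq_le_sq.2 (abs_abs_sub_abs_le_abs_sub (h (a k)) (h (b k)))
    linarith
  have hm0 : 0 ≤ m := abs_nonneg _
  have hmm : m * ∑ v, |C v| ≤ m * 4 := mul_le_mul_of_nonneg_left hsum hm0
  unfold energy at h2 ⊢
  push_cast at hsum2
  linarith

theorem abs_clamp_sub_clamp_le (l u x y : ℝ) :
    |max l (min u x) - max l (min u y)| ≤ |x - y| := by
  refine (abs_max_sub_max_le_max _ _ _ _).trans (max_le (by simp) ?_)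
  exact (abs_min_sub_min_le_max _ _ _ _).trans (max_le (by simp) le_rfl)

/-- An integer charge of energy at most `lam` is, up to a constant, a `{-1, 0, 1}`-valued
function with at most two nonzero values. -/
theorem IsStiff.exists_small_shift {V ι : Type*} [Fintype V] [Fintype ι] {r lam : ℝ}
    {a b : ι → V} (hst : IsStiff r lam a b) (hr : 0 ≤ r) (hlam : 2 ≤ lam)
    (hV : 7 ≤ Fintype.card V) (C : V → ℤ) (h : V → ℝ)
    (hE : energy r a b (fun v => (C v : ℝ)) h ≤ lam) :
    ∃ k : ℤ, (∀ v, |C v - k| ≤ 1) ∧ (Finset.univ.filter fun v => C v ≠ k).card ≤ 2 := by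
  have hthr : ∀ (T : Finset V) (η : ℝ → ℝ), (∀ x y, |η x - η y| ≤ |x - y|) →
      (∀ v, η (C v) = finsetIndicator T v) → 3 ≤ T.card → ¬ T.card + 3 ≤ Fintype.card V := by
    intro T η hη hT h3 h4
    have h5 := energy_comp_le hr a b (fun v => (C v : ℝ)) h hη
    simp only [hT] at h5
    exact absurd (hst.2 T _ h3 h4) (not_lt.2 (h5.trans hE))
  have hup : ∀ k : ℤ, 3 ≤ (Finset.univ.filter fun v => k ≤ C v).card →
      Fintype.card V ≤ (Finset.univ.filter fun v => k ≤ C v).card + 2 := by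
    intro k hk
    have := hthr (Finset.univ.filter fun v => k ≤ C v) (fun x => max 0 (min 1 (x - (k - 1))))
      (fun x y => (abs_clamp_sub_clamp_le _ _ _ _).trans (by rw [sub_sub_sub_cancel_right]))
      (fun v => by
        unfold finsetIndicator
        simp only [Finset.mem_filter, Finset.mem_univ, true_and]
        by_cases hv : k ≤ C v
        · have : (k : ℝ) ≤ C v := by exact_mod_cast hv
          rw [if_pos hv, min_eq_left (by linarith), max_eq_right (by simp)]
        · have : (C v : ℝ) ≤ k - 1 := by exact_mod_cast Int.le_sub_one_of_lt (not_le.1 hv)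
          rw [if_neg hv, min_eq_right (by linarith), max_eq_left (by linarith)]) hk
    omega
  have : Nonempty V := Fintype.card_pos_iff.1 (by omega)
  obtain ⟨vmax, -, hmax⟩ := Finset.exists_max_image Finset.univ C Finset.univ_nonempty
  obtain ⟨vmin, -, hmin⟩ := Finset.exists_min_image Finset.univ C Finset.univ_nonempty
  obtain ⟨k, hk, hkmax⟩ := Int.exists_greatest_of_bdd
    (P := fun k => 3 ≤ (Finset.univ.filter fun v => k ≤ C v).card)
    ⟨C vmax, fun z hz => by
      obtain ⟨v, hv⟩ := Finset.card_pos.1 ((Nat.zero_lt_succ 2).trans_le hz)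
      exact (Finset.mem_filter.1 hv).2.trans (hmax v (Finset.mem_univ _))⟩
    ⟨C vmin, by
      rw [Finset.filter_true_of_mem fun v hv => hmin v hv, Finset.card_univ]; omega⟩
  have hk1 : (Finset.univ.filter fun v => k + 1 ≤ C v).card ≤ 2 := by
    by_contra hc
    have := hkmax (k + 1) (by omega)
    omega
  have hk2 := hup k hk
  have hk3 : (Finset.univ.filter fun v => ¬ k ≤ C v).card ≤ 2 := by
    have := Finset.card_filter_add_card_filter_not (s := Finset.univ) (fun v => k ≤ C v)
    rw [Finset.card_univ] at this
    omega
  have hS4 : (Finset.univ.filter fun v => C v ≠ k).card ≤ 4 := by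
    refine (Finset.card_le_card (t := (Finset.univ.filter fun v => k + 1 ≤ C v) ∪
      Finset.univ.filter fun v => ¬ k ≤ C v) fun v hv => ?_).trans
      ((Finset.card_union_le _ _).trans (by omega))
    have := (Finset.mem_filter.1 hv).2
    simp only [Finset.mem_union, Finset.mem_filter, Finset.mem_univ, true_and]
    omega
  have hS : (Finset.univ.filter fun v => C v ≠ k).card ≤ 2 := by
    by_contra hc
    refine hthr (Finset.univ.filter fun v => C v ≠ k) (fun x => min 1 |x - k|) (fun x y => ?_) (fun v => ?_) (by omega) (by omega)
    · refine (abs_min_sub_min_le_max _ _ _ _).trans (max_le (by simp) ?_)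
      exact (abs_abs_sub_abs_le_abs_sub _ _).trans (by rw [sub_sub_sub_cancel_right])
    · unfold finsetIndicator
      simp only [Finset.mem_filter, Finset.mem_univ, true_and]
      by_cases hv : C v = k
      · simp [hv]
      · have : (1 : ℝ) ≤ |(C v : ℝ) - k| := by
          exact_mod_cast Int.one_le_abs (sub_ne_zero.2 hv)
        rw [if_pos hv, min_eq_left this]
  refine ⟨k, fun v0 => ?_, hS⟩
  by_contra hc
  set D : V → ℝ := fun v => max (-2) (min 2 ((C v : ℝ) - k)) with hD
  have hD2 : ∀ v, |D v| ≤ 2 := fun v =>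
    abs_le.2 ⟨le_max_left _ _, max_le (by norm_num) (min_le_left _ _)⟩
  have hsum : ∑ v, |D v| ≤ 4 := by
    calc ∑ v, |D v| ≤ ∑ v, if C v ≠ k then (2 : ℝ) else 0 := by
          refine Finset.sum_le_sum fun v _ => ?_
          split_ifs with hv
          · exact hD2 v
          · simp only [ne_eq, not_not] at hv
            simp [hD, hv]
      _ = (Finset.univ.filter fun v => C v ≠ k).card * 2 := by
          rw [← Finset.sum_filter, Finset.sum_const, nsmul_eq_mul]
      _ ≤ 4 := by
          have : ((Finset.univ.filter fun v => C v ≠ k).card : ℝ) ≤ 2 := by exact_mod_cast hS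
          linarith
  have h1 := hst.lt_energy_of_sum_abs_le hr hlam (by omega) D
    (fun v => max (-2) (min 2 (h v - k))) hD2 hsum
  have h2 := energy_comp_le hr a b (fun v => (C v : ℝ)) h
    (η := fun x => max (-2) (min 2 (x - k))) (fun x y =>
      (abs_clamp_sub_clamp_le _ _ _ _).trans (by rw [sub_sub_sub_cancel_right]))
  have h3 : D v0 ^ 2 ≤ ∑ v, D v ^ 2 :=
    Finset.single_le_sum (f := fun v => D v ^ 2) (fun _ _ => sq_nonneg _) (Finset.mem_univ v0)
  have h4 : D v0 ^ 2 = 4 := by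
    have h5 : (2 : ℝ) ≤ |(C v0 : ℝ) - k| := by
      have : 2 ≤ |C v0 - k| := by omega
      exact_mod_cast this
    rcases le_abs.1 h5 with h6 | h6
    · simp only [hD]; rw [min_eq_left h6, max_eq_right (by norm_num)]; norm_num
    · simp only [hD]; rw [min_eq_right (by linarith), max_eq_left (by linarith)]; norm_num
  have h5 := h1.trans_le (h2.trans hE)
  linarith

/-- Minimizing a nonnegative quadratic form over a translate of the range of `E` bounds a spring
energy. -/
theorem exists_potential_of_nonneg {U V ι : Type*} [Fintype U] [Fintype V] [Fintype ι]
    {M : Matrix U U ℝ} (hM : M.IsSymm) (hpos : ∀ x : U → ℝ, 0 ≤ x ⬝ᵥ M *ᵥ x)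
    (E : Matrix U ι ℝ) (D : Matrix ι V ℝ) {μ : ℝ} (hμ : 0 < μ)
    (hE : Eᵀ * M * E = D * Dᵀ + μ • 1) (z : U → ℝ) (c : V → ℝ)
    (hz : Eᵀ *ᵥ (M *ᵥ z) = D *ᵥ c) :
    ∃ h : V → ℝ, (c - h) ⬝ᵥ (c - h) + 1 / μ * ((D *ᵥ h) ⬝ᵥ (D *ᵥ h)) ≤ z ⬝ᵥ M *ᵥ z := by
  obtain ⟨h, hh⟩ : ∃ h : V → ℝ, (1 + (1 / μ) • (Dᵀ * D)) *ᵥ h = c := by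
    have hinj : Function.Injective (Matrix.mulVecLin (1 + (1 / μ) • (Dᵀ * D))) := by
      rw [← LinearMap.ker_eq_bot, LinearMap.ker_eq_bot']
      intro y hy
      have h1 : y ⬝ᵥ (1 + (1 / μ) • (Dᵀ * D)) *ᵥ y = 0 := by
        rw [Matrix.mulVecLin_apply] at hy
        rw [hy, dotProduct_zero]
      rw [Matrix.add_mulVec, Matrix.one_mulVec, Matrix.smul_mulVec, dotProduct_add,
        dotProduct_smul, ← Matrix.mulVec_mulVec, Matrix.dotProduct_mulVec,
        Matrix.vecMul_transpose] at h1
      have h2 : 0 ≤ (D *ᵥ y) ⬝ᵥ (D *ᵥ y) :=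
        Finset.sum_nonneg fun _ _ => mul_self_nonneg _
      have h3 : 0 ≤ y ⬝ᵥ y := Finset.sum_nonneg fun _ _ => mul_self_nonneg _
      have h4 : 0 ≤ (1 / μ) • ((D *ᵥ y) ⬝ᵥ (D *ᵥ y)) := by
        rw [smul_eq_mul]; positivity
      exact dotProduct_self_eq_zero.1 (by linarith)
    exact LinearMap.injective_iff_surjective.1 hinj c
  refine ⟨h, ?_⟩
  set d := D *ᵥ h with hd
  have hDd : Dᵀ *ᵥ d = μ • (c - h) := by
    rw [← hh, Matrix.add_mulVec, Matrix.one_mulVec, add_sub_cancel_left, Matrix.smul_mulVec,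
      smul_smul, mul_one_div_cancel hμ.ne', one_smul, ← Matrix.mulVec_mulVec]
  set y : ι → ℝ := -(1 / μ) • d with hy
  have hDy : Dᵀ *ᵥ y = h - c := by
    rw [hy, Matrix.mulVec_smul, hDd, smul_smul, neg_mul, one_div_mul_cancel hμ.ne', neg_one_smul,
      neg_sub]
  have h0 := hpos (z + E *ᵥ y)
  have e1 : (E *ᵥ y) ⬝ᵥ M *ᵥ z = y ⬝ᵥ D *ᵥ c := by
    rw [← hz, dotProduct_comm, Matrix.dotProduct_mulVec, dotProduct_comm, Matrix.mulVec_transpose]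
  have e2 : z ⬝ᵥ M *ᵥ (E *ᵥ y) = y ⬝ᵥ D *ᵥ c := by
    rw [← e1, Matrix.dotProduct_mulVec, dotProduct_comm, ← Matrix.mulVec_transpose, hM.eq]
  have e3 : (E *ᵥ y) ⬝ᵥ M *ᵥ (E *ᵥ y) = (h - c) ⬝ᵥ (h - c) + μ * (y ⬝ᵥ y) := by
    have : (E *ᵥ y) ⬝ᵥ M *ᵥ (E *ᵥ y) = y ⬝ᵥ (Eᵀ * M * E) *ᵥ y := by
      rw [← Matrix.mulVec_mulVec, ← Matrix.mulVec_mulVec, Matrix.dotProduct_mulVec y Eᵀ,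
        Matrix.vecMul_transpose]
    rw [this, hE, Matrix.add_mulVec, dotProduct_add, ← Matrix.mulVec_mulVec, hDy,
      Matrix.smul_mulVec, Matrix.one_mulVec, dotProduct_smul, smul_eq_mul,
      Matrix.dotProduct_mulVec, ← Matrix.mulVec_transpose, hDy]
  rw [Matrix.mulVec_add, dotProduct_add, add_dotProduct, add_dotProduct, e1, e2, e3] at h0
  have e4 : y ⬝ᵥ D *ᵥ c = (h - c) ⬝ᵥ c := by
    rw [Matrix.dotProduct_mulVec, ← Matrix.mulVec_transpose, hDy]
  have e5 : μ * (y ⬝ᵥ y) = 1 / μ * (d ⬝ᵥ d) := by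
    rw [hy, smul_dotProduct, dotProduct_smul, smul_eq_mul, smul_eq_mul]
    field_simp
  have e6 : 1 / μ * (d ⬝ᵥ d) = (c - h) ⬝ᵥ h := by
    have : d ⬝ᵥ d = μ * ((c - h) ⬝ᵥ h) := by
      nth_rw 2 [hd]
      rw [Matrix.dotProduct_mulVec, ← Matrix.mulVec_transpose, hDd, smul_dotProduct, smul_eq_mul]
    rw [this]; field_simp
  have e7 : (h - c) ⬝ᵥ c = -((c - h) ⬝ᵥ (c - h)) - (c - h) ⬝ᵥ h := by
    rw [← neg_sub c h, neg_dotProduct, dotProduct_sub]; ring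
  have e8 : (h - c) ⬝ᵥ (h - c) = (c - h) ⬝ᵥ (c - h) := by
    rw [← neg_sub c h, neg_dotProduct, dotProduct_neg, neg_neg]
  rw [e4, e5, e7, e8] at h0
  linarith

/-- The vector `s k • (e_{a k} - e_{b k})`. -/
noncomputable def edgeVec {V ι : Type*} (a b : ι → V) (s : ι → ℤ) (k : ι) (v : V) : ℤ :=
  s k * ((if v = a k then 1 else 0) - if v = b k then 1 else 0)

theorem sum_edgeVec_mul {V ι : Type*} [Fintype V] (a b : ι → V) (s : ι → ℤ) (k : ι)
    (x : V → ℤ) : ∑ v, edgeVec a b s k v * x v = s k * (x (a k) - x (b k)) := by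
  simp [edgeVec, mul_assoc, sub_mul, ← Finset.mul_sum, Finset.sum_sub_distrib]

/-- A representation of a principal submatrix of `A + 2` as the Gram matrix of signed edge
vectors of a tree. -/
structure TreeRep {U : Type*} (A : Matrix U U ℤ) (ι V : Type*) [Fintype ι] [Fintype V] where
  /-- the vertex represented by an edge -/
  f : ι → U
  /-- the first endpoint of an edge -/
  a : ι → V
  /-- the second endpoint of an edge -/
  b : ι → V
  /-- the sign of an edge -/
  s : ι → ℤ
  inj : Function.Injective f
  sign : ∀ k, s k = 1 ∨ s k = -1
  ne : ∀ k, a k ≠ b k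
  gram : ∀ j k, j ≠ k → A (f j) (f k) = s j * (edgeVec a b s k (a j) - edgeVec a b s k (b j))
  exists_potential : ∀ g : ι → ℤ, ∃ c : V → ℤ, ∀ k, c (a k) - c (b k) = g k
  cuts : CrossesCuts a b
  card_eq : Fintype.card V = Fintype.card ι + 1

/-- The quadratic form matrix `A + lam`. -/
noncomputable def shifted {U : Type*} (A : Matrix U U ℤ) (lam : ℝ) : Matrix U U ℝ :=
  A.map (fun x => (x : ℝ)) + lam • (1 : Matrix U U ℝ)

theorem shifted_isSymm {U : Type*} {A : Matrix U U ℤ} (hA : A.IsSymm) (lam : ℝ) :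
    (shifted A lam).IsSymm := by
  unfold Matrix.IsSymm shifted
  rw [Matrix.transpose_add, Matrix.transpose_smul, Matrix.transpose_one, ← Matrix.transpose_map,
    hA.eq]

namespace TreeRep

variable {U : Type*} {A : Matrix U U ℤ} {ι V : Type*} [Fintype ι] [Fintype V]

theorem sign_sq (F : TreeRep A ι V) (k : ι) : F.s k * F.s k = 1 := by
  rcases F.sign k with h | h <;> rw [h] <;> norm_num

theorem exists_energy_le [Fintype U] (F : TreeRep A ι V) (hA : A.IsSymm) (hd : ∀ u, A u u = 0)
    {lam r : ℝ} (hlam : 2 < lam) (hr : r ≤ 1 / (lam - 2))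
    (hpos : ∀ x : U → ℝ, 0 ≤ x ⬝ᵥ shifted A lam *ᵥ x) (z : U → ℝ) (c : V → ℝ)
    (hz : ∀ k, F.s k * (shifted A lam *ᵥ z) (F.f k) = c (F.a k) - c (F.b k)) :
    ∃ h : V → ℝ, energy r F.a F.b c h ≤ z ⬝ᵥ shifted A lam *ᵥ z := by
  let E : Matrix U ι ℝ := fun u k => if u = F.f k then (F.s k : ℝ) else 0
  let D : Matrix ι V ℝ := fun k v => (if v = F.a k then 1 else 0) - if v = F.b k then 1 else 0
  have hD : ∀ x : V → ℝ, ∀ k, (D *ᵥ x) k = x (F.a k) - x (F.b k) := by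
    intro x k
    simp [D, Matrix.mulVec, dotProduct, sub_mul, Finset.sum_sub_distrib]
  have hE : ∀ x : U → ℝ, ∀ k, (Eᵀ *ᵥ x) k = F.s k * x (F.f k) := by
    intro x k
    change ∑ u, (if u = F.f k then (F.s k : ℝ) else 0) * x u = _
    simp
  obtain ⟨h, hh⟩ := exists_potential_of_nonneg (shifted_isSymm hA lam) hpos E D
    (show 0 < lam - 2 by linarith) (by
      ext j k
      have h1 : (Eᵀ * shifted A lam * E) j k =
          F.s j * (shifted A lam (F.f j) (F.f k) * F.s k) := by
        rw [Matrix.mul_assoc]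
        have := hE ((shifted A lam * E).col k) j
        rw [show (Eᵀ * (shifted A lam * E)) j k = (Eᵀ *ᵥ ((shifted A lam * E).col k)) j from rfl,
          this]
        congr 1
        change ∑ u, shifted A lam (F.f j) u * (if u = F.f k then (F.s k : ℝ) else 0) = _
        simp
      have h2 : (D * Dᵀ) j k = D k (F.a j) - D k (F.b j) := hD (D k) j
      rw [h1, Matrix.add_apply, h2, Matrix.smul_apply]
      by_cases hjk : j = k
      · subst hjk
        have h3 : (F.s j : ℝ) * F.s j = 1 := by exact_mod_cast F.sign_sq j
        have h4 : shifted A lam (F.f j) (F.f j) = lam := by simp [shifted, hd]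
        have h5 := F.ne j
        rw [h4, mul_left_comm, h3]
        simp [D, h5, h5.symm]
        ring
      · have h3 : (F.s k : ℝ) * F.s k = 1 := by exact_mod_cast F.sign_sq k
        have h3' : (F.s j : ℝ) * F.s j = 1 := by exact_mod_cast F.sign_sq j
        have h4 : shifted A lam (F.f j) (F.f k) = F.s j * F.s k *
            (D k (F.a j) - D k (F.b j)) := by
          have h5 : F.f j ≠ F.f k := fun h => hjk (F.inj h)
          simp only [shifted, Matrix.add_apply, Matrix.map_apply, Matrix.smul_apply,
            Matrix.one_apply_ne h5, smul_zero, add_zero, F.gram j k hjk, edgeVec, D]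
          push_cast
          ring
        rw [h4, Matrix.one_apply_ne hjk, smul_zero, add_zero]
        linear_combination (D k (F.a j) - D k (F.b j)) * ((F.s k : ℝ) * F.s k * h3' + h3)) z c
    (by ext k; rw [hE, hD, hz])
  refine ⟨h, le_trans ?_ hh⟩
  unfold energy
  refine add_le_add (le_of_eq ?_) (mul_le_mul hr (le_of_eq ?_)
    (Finset.sum_nonneg fun _ _ => sq_nonneg _) (by
      have : 0 < lam - 2 := by linarith
      positivity))
  · exact Finset.sum_congr rfl fun v _ => by rw [Pi.sub_apply, sq]
  · exact Finset.sum_congr rfl fun k _ => by rw [hD, sq]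

/-- Adding a vertex attached at a single coordinate. -/
theorem nonempty_extend (F : TreeRep A ι V) (hA : A.IsSymm) {v : U} (hv : v ∉ Set.range F.f)
    (i : V) (σ : ℤ) (hσ : σ = 1 ∨ σ = -1)
    (hi : ∀ k, A v (F.f k) = σ * edgeVec F.a F.b F.s k i) :
    Nonempty (TreeRep A (Option ι) (Option V)) := by
  set a' : Option ι → Option V := fun o => o.elim (some i) (fun k => some (F.a k)) with ha'
  set b' : Option ι → Option V := fun o => o.elim none (fun k => some (F.b k)) with hb'
  set s' : Option ι → ℤ := fun o => o.elim σ F.s with hs'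
  have hg : ∀ k, A v (F.f k) = σ * (edgeVec a' b' s' (some k) (some i) -
      edgeVec a' b' s' (some k) none) := by
    intro k
    rw [hi k]
    simp [edgeVec, ha', hb', hs']
  have hg' : ∀ k, A (F.f k) v = F.s k * (edgeVec a' b' s' none (some (F.a k)) -
      edgeVec a' b' s' none (some (F.b k))) := by
    intro k
    rw [hA.apply, hi k]
    simp [edgeVec, ha', hb', hs', eq_comm]
    split_ifs <;> ring
  refine ⟨⟨fun o => o.elim v F.f, a', b', s', ?_, ?_, ?_, ?_, ?_, ?_, ?_⟩⟩
  · rintro (_ | j) (_ | k) h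
    · rfl
    · exact absurd ⟨k, h.symm⟩ hv
    · exact absurd ⟨j, h⟩ hv
    · exact congrArg some (F.inj h)
  · rintro (_ | k)
    · exact hσ
    · exact F.sign k
  · rintro (_ | k)
    · simp [ha', hb']
    · simpa [ha', hb'] using F.ne k
  · rintro (_ | j) (_ | k) h
    · exact absurd rfl h
    · exact hg k
    · exact hg' j
    · have := F.gram j k fun hjk => h (congrArg some hjk)
      simpa [edgeVec, ha', hb', hs'] using this
  · intro g
    obtain ⟨c, hc⟩ := F.exists_potential fun k => g (some k)
    refine ⟨fun o => o.elim (c i - g none) c, ?_⟩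
    rintro (_ | k)
    · simp [ha', hb']
    · simpa [ha', hb'] using hc k
  · intro S hS hS'
    by_cases h1 : (some ⁻¹' S : Set V).Nonempty
    · by_cases h2 : (some ⁻¹' S : Set V)ᶜ.Nonempty
      · obtain ⟨k, hk⟩ := F.cuts _ h1 h2
        exact ⟨some k, hk⟩
      · have h3 : ∀ w, some w ∈ S := by
          intro w
          by_contra hw
          exact h2 ⟨w, hw⟩
        obtain ⟨o, ho⟩ := hS'
        refine ⟨none, Or.inl ⟨h3 i, ?_⟩⟩
        cases o with
        | none => exact ho
        | some w => exact absurd (h3 w) ho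
    · have h3 : ∀ w, some w ∉ S := fun w hw => h1 ⟨w, hw⟩
      obtain ⟨o, ho⟩ := hS
      refine ⟨none, Or.inr ⟨?_, h3 i⟩⟩
      cases o with
      | none => exact ho
      | some w => exact absurd ho (h3 w)
  · rw [Fintype.card_option, Fintype.card_option, F.card_eq]

end TreeRep

/-- Existence of a tree representation with `n` coordinates. -/
def HasTreeRep {U : Type*} (A : Matrix U U ℤ) (n : ℕ) : Prop :=
  ∃ (ι V : Type) (_ : Fintype ι) (_ : Fintype V),
    Nonempty (TreeRep A ι V) ∧ Fintype.card V = n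

/-- The set where an integer function is nonzero. -/
noncomputable def supportFinset {V : Type*} [Fintype V] (c : V → ℤ) : Finset V :=
  Finset.univ.filter fun v => c v ≠ 0

theorem abs_eq_finsetIndicator {V : Type*} [Fintype V] {c : V → ℤ} (hc : ∀ v, |c v| ≤ 1) (v : V) :
    |(c v : ℝ)| = finsetIndicator (supportFinset c) v := by
  simp only [finsetIndicator, supportFinset, Finset.mem_filter, Finset.mem_univ, true_and]
  split_ifs with h
  · have := Int.one_le_abs h
    exact_mod_cast le_antisymm (hc v) this
  · simp [not_not.1 h]

theorem sum_sq_eq_card_support {V : Type*} [Fintype V] {c : V → ℤ} (hc : ∀ v, |c v| ≤ 1) :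
    ∑ v, c v * c v = (supportFinset c).card := by
  rw [supportFinset, Finset.card_filter]
  push_cast
  refine Finset.sum_congr rfl fun v _ => ?_
  obtain ⟨h1, h2⟩ := abs_le.1 (hc v)
  have : c v = -1 ∨ c v = 0 ∨ c v = 1 := by omega
  rcases this with h | h | h <;> simp [h]

theorem sum_abs_eq_card_support {V : Type*} [Fintype V] {c : V → ℤ} (hc : ∀ v, |c v| ≤ 1) :
    ∑ v, |(c v : ℝ)| = (supportFinset c).card := by
  simp_rw [abs_eq_finsetIndicator hc, sum_finsetIndicator]

namespace TreeRep

variable {U : Type*} {A : Matrix U U ℤ} {ι V : Type*} [Fintype ι] [Fintype V]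

/-- A potential whose differences along the edges are the adjacencies of the vertex `v`. -/
def IsPotential (F : TreeRep A ι V) (v : U) (c : V → ℤ) : Prop :=
  ∀ k, c (F.a k) - c (F.b k) = F.s k * A v (F.f k)

theorem IsPotential.eq_mul {F : TreeRep A ι V} {v : U} {c : V → ℤ} (hc : F.IsPotential v c)
    (k : ι) : F.s k * (c (F.a k) - c (F.b k)) = A v (F.f k) := by
  rw [hc k, ← mul_assoc, F.sign_sq, one_mul]

theorem exists_energy_pair_le [Fintype U] (F : TreeRep A ι V) (hA : A.IsSymm)
    (hd : ∀ u, A u u = 0) {lam r : ℝ} (hlam : 2 < lam) (hr : r ≤ 1 / (lam - 2))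
    (hpos : ∀ x : U → ℝ, 0 ≤ x ⬝ᵥ shifted A lam *ᵥ x) {v w : U} (hvw : v ≠ w)
    (hv : v ∉ Set.range F.f) (hw : w ∉ Set.range F.f) {c d : V → ℤ} (hc : F.IsPotential v c)
    (hc' : F.IsPotential w d) (α β : ℝ) :
    ∃ h : V → ℝ, energy r F.a F.b (fun i => α * c i + β * d i) h ≤
      (α ^ 2 + β ^ 2) * lam + 2 * α * β * A v w := by
  have hmul : ∀ u, (shifted A lam *ᵥ (Pi.single v α + Pi.single w β)) u =
      α * shifted A lam u v + β * shifted A lam u w := by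
    intro u
    simp [Matrix.mulVec_add, Matrix.mulVec_single]
  have hoff : ∀ u u', u ≠ u' → shifted A lam u u' = A u u' := by
    intro u u' h
    simp [shifted, Matrix.one_apply_ne h]
  have hdiag : ∀ u, shifted A lam u u = lam := by
    intro u
    simp [shifted, hd]
  obtain ⟨h, hh⟩ := F.exists_energy_le hA hd hlam hr hpos (Pi.single v α + Pi.single w β)
    (fun i => α * c i + β * d i) (by
      intro k
      rw [hmul, hoff _ _ fun h => hv ⟨k, h⟩, hoff _ _ fun h => hw ⟨k, h⟩]
      have h1 : (c (F.a k) - c (F.b k) : ℝ) = F.s k * A v (F.f k) := by exact_mod_cast hc k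
      have h2 : (d (F.a k) - d (F.b k) : ℝ) = F.s k * A w (F.f k) := by exact_mod_cast hc' k
      rw [hA.apply v, hA.apply w]
      linear_combination -α * h1 - β * h2)
  refine ⟨h, hh.trans (le_of_eq ?_)⟩
  rw [add_dotProduct, single_dotProduct, single_dotProduct, hmul, hmul, hdiag, hdiag,
    hoff _ _ hvw, hoff _ _ hvw.symm, hA.apply v w]
  ring

theorem exists_small_potential [Fintype U] (F : TreeRep A ι V) (hA : A.IsSymm)
    (hd : ∀ u, A u u = 0) {lam r : ℝ} (hlam : 2 < lam) (hr0 : 0 ≤ r) (hr : r ≤ 1 / (lam - 2))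
    (hpos : ∀ x : U → ℝ, 0 ≤ x ⬝ᵥ shifted A lam *ᵥ x) (hst : IsStiff r lam F.a F.b)
    (hV : 7 ≤ Fintype.card V) (hmax : ¬ Nonempty (TreeRep A (Option ι) (Option V))) {v : U}
    (hv : v ∉ Set.range F.f) :
    ∃ c : V → ℤ, F.IsPotential v c ∧ (∀ i, |c i| ≤ 1) ∧
      ((supportFinset c).card = 0 ∨ (supportFinset c).card = 2) := by
  obtain ⟨C, hC⟩ := F.exists_potential fun k => F.s k * A v (F.f k)
  have hoff : ∀ k, shifted A lam (F.f k) v = A v (F.f k) := by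
    intro k
    have : F.f k ≠ v := fun h => hv ⟨k, h⟩
    simp [shifted, Matrix.one_apply_ne this, hA.apply v]
  obtain ⟨h, hh⟩ := F.exists_energy_le hA hd hlam hr hpos (Pi.single v 1)
    (fun i => (C i : ℝ)) (by
      intro k
      rw [Matrix.mulVec_single_one, Matrix.col_apply, hoff]
      exact_mod_cast (hC k).symm)
  obtain ⟨k0, hk1, hk2⟩ := hst.exists_small_shift hr0 hlam.le hV C h (hh.trans (le_of_eq (by
    rw [Matrix.mulVec_single_one, single_dotProduct, Matrix.col_apply]
    simp [shifted, hd])))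
  set c : V → ℤ := fun i => C i - k0 with hc
  have hpot : F.IsPotential v c := fun k => by rw [← hC k]; simp [hc]
  refine ⟨c, hpot, hk1, ?_⟩
  have hcard : (supportFinset c).card ≤ 2 := by
    simpa only [supportFinset, hc, sub_ne_zero] using hk2
  by_contra hcon
  have h1 : (supportFinset c).card = 1 := by omega
  obtain ⟨i, hi⟩ := Finset.card_eq_one.1 h1
  have hi' : ∀ j, c j = c i * if j = i then 1 else 0 := by
    intro j
    split_ifs with hj
    · rw [hj, mul_one]
    · by_contra hne
      have : j ∈ supportFinset c := by
        rw [mul_zero] at hne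
        simpa [supportFinset] using hne
      rw [hi] at this
      exact hj (Finset.mem_singleton.1 this)
  have hne : c i ≠ 0 := by
    have : i ∈ supportFinset c := by rw [hi]; exact Finset.mem_singleton_self i
    exact (Finset.mem_filter.1 this).2
  have hb := hk1 i
  refine hmax (F.nonempty_extend hA hv i (c i) ?_ fun k => ?_)
  · have := abs_le.1 hb
    simp only [hc] at hne ⊢
    omega
  · rw [← hpot.eq_mul k, hi' (F.a k), hi' (F.b k), edgeVec]
    simp only [eq_comm (a := i)]
    ring

/-- A maximal tree representation on a large tree extends to a Gram representation of `A + 2`. -/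
theorem exists_gram_of_maximal [Fintype U] (F : TreeRep A ι V) (hA : A.IsSymm)
    (hd : ∀ u, A u u = 0) (hent : ∀ u w, A u w = -1 ∨ A u w = 0 ∨ A u w = 1)
    (hconn : ∀ S : Set U, S.Nonempty → Sᶜ.Nonempty → ∃ u ∈ S, ∃ w ∉ S, A u w ≠ 0)
    {lam r : ℝ} (hlam : 2 < lam) (hr0 : 0 ≤ r) (hr : r ≤ 1 / (lam - 2))
    (hpos : ∀ x : U → ℝ, 0 ≤ x ⬝ᵥ shifted A lam *ᵥ x) (hst : IsStiff r lam F.a F.b)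
    (hV : 7 ≤ Fintype.card V) (hmax : ¬ Nonempty (TreeRep A (Option ι) (Option V))) :
    ∃ ρ : U → V → ℤ, ∀ u w, (A u w + if u = w then 2 else 0) = ∑ i, ρ u i * ρ w i := by
  have hsmall := fun v (hv : v ∉ Set.range F.f) =>
    F.exists_small_potential hA hd hlam hr0 hr hpos hst hV hmax hv
  have htwo : ∀ v ∉ Set.range F.f, ∃ c : V → ℤ, F.IsPotential v c ∧ (∀ i, |c i| ≤ 1) ∧
      (supportFinset c).card = 2 := by
    by_contra! hcon
    obtain ⟨v, hv, hvc⟩ := hcon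
    set Z : Set U := {u | u ∉ Set.range F.f ∧ ∀ k, A u (F.f k) = 0} with hZ
    have hι : 0 < Fintype.card ι := by have := F.card_eq; omega
    obtain ⟨k0⟩ := Fintype.card_pos_iff.1 hι
    have hvZ : v ∈ Z := by
      obtain ⟨c, hc1, hc2, hc3⟩ := hsmall v hv
      refine ⟨hv, fun k => ?_⟩
      have h0 : supportFinset c = ∅ := Finset.card_eq_zero.1 (hc3.resolve_right (hvc c hc1 hc2))
      have h1 : ∀ i, c i = 0 := by
        intro i
        by_contra hne
        have : i ∈ supportFinset c := by simpa [supportFinset] using hne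
        simp [h0] at this
      rw [← hc1.eq_mul k, h1, h1, sub_self, mul_zero]
    obtain ⟨u, hu, w, hw, huw⟩ := hconn Z ⟨v, hvZ⟩ ⟨F.f k0, fun h => h.1 ⟨k0, rfl⟩⟩
    have hwr : w ∉ Set.range F.f := by
      rintro ⟨k, rfl⟩
      exact huw (hu.2 k)
    obtain ⟨c, hc1, hc2, hc3⟩ := hsmall w hwr
    have hc4 : (supportFinset c).card = 2 := by
      refine hc3.resolve_left fun h0 => hw ⟨hwr, fun k => ?_⟩
      have h0 := Finset.card_eq_zero.1 h0
      have h1 : ∀ i, c i = 0 := by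
        intro i
        by_contra hne
        have : i ∈ supportFinset c := by simpa [supportFinset] using hne
        simp [h0] at this
      rw [← hc1.eq_mul k, h1, h1, sub_self, mul_zero]
    have hu0 : F.IsPotential u fun _ => 0 := fun k => by rw [hu.2 k]; simp
    have huw' : u ≠ w := fun h => huw (by rw [h, hd])
    obtain ⟨h, hh⟩ := F.exists_energy_pair_le hA hd hlam hr hpos huw' hu.1 hwr hu0 hc1
      (-A u w / lam) 1
    have h1 := hst.1 (supportFinset c) (fun i => |h i|) hc4
    have h2 := energy_comp_le hr0 F.a F.b (fun i => (c i : ℝ)) h (η := fun x => |x|)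
      abs_abs_sub_abs_le_abs_sub
    simp only [abs_eq_finsetIndicator hc2] at h2
    have h3 : (A u w : ℝ) ^ 2 = 1 := by
      rcases hent u w with h | h | h
      · simp [h]
      · exact absurd h huw
      · simp [h]
    simp only [Int.cast_zero, mul_zero, one_mul, zero_add] at hh
    have h4 : ((-A u w / lam : ℝ) ^ 2 + 1 ^ 2) * lam + 2 * (-A u w / lam) * 1 * A u w =
        lam - 1 / lam := by
      have : lam ≠ 0 := by linarith
      field_simp
      linear_combination -h3
    linarith
  have hrho : ∀ u, ∃ ρ : V → ℤ, (∃ k, F.f k = u ∧ ρ = edgeVec F.a F.b F.s k) ∨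
      (u ∉ Set.range F.f ∧ F.IsPotential u ρ ∧ (∀ i, |ρ i| ≤ 1) ∧
        (supportFinset ρ).card = 2) := by
    intro u
    by_cases hu : u ∈ Set.range F.f
    · obtain ⟨k, hk⟩ := hu
      exact ⟨_, Or.inl ⟨k, hk, rfl⟩⟩
    · obtain ⟨c, hc⟩ := htwo u hu
      exact ⟨c, Or.inr ⟨hu, hc⟩⟩
  choose ρ hρ using hrho
  have hmix : ∀ u w, u ∉ Set.range F.f → F.IsPotential u (ρ u) → ∀ k, F.f k = w →
      ρ w = edgeVec F.a F.b F.s k → A u w = ∑ i, ρ w i * ρ u i := by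
    intro u w hu hpot k hk hw
    rw [hw, sum_edgeVec_mul, hpot.eq_mul, hk]
  refine ⟨ρ, fun u w => ?_⟩
  rcases hρ u with ⟨j, hj, hju⟩ | ⟨hu, hu1, hu2, hu3⟩
  · rcases hρ w with ⟨k, hk, hkw⟩ | ⟨hw, hw1, -, -⟩
    · rw [hju, hkw, sum_edgeVec_mul, ← hj, ← hk]
      by_cases hjk : j = k
      · subst hjk
        have h1 := F.ne j
        have h2 := F.sign_sq j
        simp [hd, edgeVec, h1, h1.symm]
        linarith
      · rw [← F.gram j k hjk, if_neg fun h => hjk (F.inj h), add_zero]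
    · have huw : u ≠ w := by
        rintro rfl
        exact hw ⟨j, hj⟩
      rw [if_neg huw, add_zero, hA.apply w u, hmix w u hw hw1 j hj hju]
  · rcases hρ w with ⟨k, hk, hkw⟩ | ⟨hw, hw1, hw2, hw3⟩
    · have huw : u ≠ w := by
        rintro rfl
        exact hu ⟨k, hk⟩
      rw [if_neg huw, add_zero, hmix u w hu hu1 k hk hkw]
      simp_rw [mul_comm]
    · by_cases huw : u = w
      · subst huw
        rw [sum_sq_eq_card_support hu2, hu3]
        simp [hd]
      · rw [if_neg huw, add_zero]
        have key : ∀ σ : ℤ, σ * σ = 1 → |σ| = 1 → σ * (∑ i, ρ u i * ρ w i - A u w) < 1 := by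
          intro σ hσ hσ'
          have hσr : (σ : ℝ) * σ = 1 := by exact_mod_cast hσ
          have hσr' : |(σ : ℝ)| = 1 := by exact_mod_cast hσ'
          obtain ⟨h, hh⟩ := F.exists_energy_pair_le hA hd hlam hr hpos huw hu hw hu1 hw1 1 σ
          have hpt : ∀ i, |(1 : ℝ) * ρ u i + σ * ρ w i| ≤ |(ρ u i : ℝ)| + |(ρ w i : ℝ)| := by
            intro i
            refine (abs_add_le _ _).trans (le_of_eq ?_)
            rw [abs_mul, abs_mul, hσr', abs_one, one_mul, one_mul]
          have hX := hst.lt_energy_of_sum_abs_le hr0 hlam.le (by omega)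
            (fun i => 1 * (ρ u i : ℝ) + σ * ρ w i) h (fun i => by
              refine (hpt i).trans ?_
              have h1 : |(ρ u i : ℝ)| ≤ 1 := by exact_mod_cast hu2 i
              have h2 : |(ρ w i : ℝ)| ≤ 1 := by exact_mod_cast hw2 i
              linarith) (by
              refine (Finset.sum_le_sum fun i _ => hpt i).trans (le_of_eq ?_)
              rw [Finset.sum_add_distrib, sum_abs_eq_card_support hu2,
                sum_abs_eq_card_support hw2, hu3, hw3]
              norm_num)
          have hsq : ∑ i, (1 * (ρ u i : ℝ) + σ * ρ w i) ^ 2 =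
              4 + 2 * σ * ∑ i, (ρ u i : ℝ) * ρ w i := by
            have e1 := sum_sq_eq_card_support hu2
            have e2 := sum_sq_eq_card_support hw2
            rw [hu3] at e1
            rw [hw3] at e2
            have e1' : ∑ i, (ρ u i : ℝ) * ρ u i = 2 := by exact_mod_cast e1
            have e2' : ∑ i, (ρ w i : ℝ) * ρ w i = 2 := by exact_mod_cast e2
            calc ∑ i, (1 * (ρ u i : ℝ) + σ * ρ w i) ^ 2
                = ∑ i, ((ρ u i : ℝ) * ρ u i + (σ * σ) * ((ρ w i : ℝ) * ρ w i) +
                    2 * σ * ((ρ u i : ℝ) * ρ w i)) := Finset.sum_congr rfl fun i _ => by ring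
              _ = _ := by
                rw [Finset.sum_add_distrib, Finset.sum_add_distrib, ← Finset.mul_sum,
                  ← Finset.mul_sum, e1', e2', hσr]
                norm_num
          have hfin : (σ : ℝ) * (∑ i, (ρ u i : ℝ) * ρ w i - A u w) < 1 := by
            have hσ2 : (σ : ℝ) ^ 2 = 1 := by rw [sq, hσr]
            rw [hσ2] at hh
            nlinarith
          exact_mod_cast hfin
        have k1 := key 1 (by norm_num) (by norm_num)
        have k2 := key (-1) (by norm_num) (by norm_num)
        omega

end TreeRep

theorem hasTreeRep_of_clique {U : Type*} {A : Matrix U U ℤ} (T : Finset U) (s : U → ℤ)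
    (hs : ∀ u ∈ T, s u = 1 ∨ s u = -1)
    (hA : ∀ u ∈ T, ∀ w ∈ T, u ≠ w → A u w = s u * s w) : HasTreeRep A (T.card + 1) := by
  let f : Fin T.card → U := fun k => (T.equivFin.symm k : U)
  have hf : ∀ k, f k ∈ T := fun k => (T.equivFin.symm k).2
  have hinj : Function.Injective f := Subtype.val_injective.comp T.equivFin.symm.injective
  refine ⟨Fin T.card, Option (Fin T.card), inferInstance, inferInstance,
    ⟨⟨f, fun _ => none, some, fun k => s (f k), hinj, fun k => hs _ (hf k), fun k => by simp,
      fun j k hjk => ?_, fun g => ⟨fun o => o.elim 0 fun k => -g k, fun k => by simp⟩,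
      fun S hS hS' => ?_, by simp⟩⟩, by simp⟩
  · rw [hA _ (hf j) _ (hf k) (hinj.ne hjk)]
    simp [edgeVec, hjk]
  · by_cases h : none ∈ S
    · obtain ⟨o, ho⟩ := hS'
      cases o with
      | none => exact absurd h ho
      | some k => exact ⟨k, Or.inl ⟨h, ho⟩⟩
    · obtain ⟨o, ho⟩ := hS
      cases o with
      | none => exact absurd ho h
      | some k => exact ⟨k, Or.inr ⟨ho, h⟩⟩

theorem hasTreeRep_of_path {U : Type*} {A : Matrix U U ℤ} (hA : A.IsSymm) {m : ℕ} (u : ℕ → U)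
    (hinj : ∀ i < m, ∀ j < m, u i = u j → i = j)
    (hadj : ∀ i, i + 1 < m → A (u i) (u (i + 1)) = 1 ∨ A (u i) (u (i + 1)) = -1)
    (hfar : ∀ i j, i + 2 ≤ j → j < m → A (u i) (u j) = 0) : HasTreeRep A (m + 1) := by
  let s : ℕ → ℤ := fun i => ∏ l ∈ Finset.range i, -A (u l) (u (l + 1))
  have hs1 : ∀ i, s (i + 1) = s i * -A (u i) (u (i + 1)) := fun i => Finset.prod_range_succ _ _
  have hs : ∀ i < m, s i = 1 ∨ s i = -1 := by
    intro i
    induction i with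
    | zero => intro _; left; simp [s]
    | succ i ih =>
      intro hi
      rw [hs1]
      rcases ih (by omega) with h | h <;> rcases hadj i hi with h' | h' <;> simp [h, h']
  have hadj' : ∀ i, i + 1 < m → A (u i) (u (i + 1)) = -(s i * s (i + 1)) := by
    intro i hi
    rw [hs1]
    rcases hs i (by omega) with h | h <;> rw [h] <;> ring
  refine ⟨Fin m, Fin (m + 1), inferInstance, inferInstance,
    ⟨⟨fun k => u k, fun k => k.castSucc, fun k => k.succ, fun k => s k,
      fun i j h => Fin.ext (hinj _ i.2 _ j.2 h), fun k => hs _ k.2,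
      fun k => by simp [Fin.ext_iff], fun j k hjk => ?_, fun g => ?_,
      fun S hS hS' => ?_, by simp⟩⟩, by simp⟩
  · have hne : (j : ℕ) ≠ k := fun h => hjk (Fin.ext h)
    have hj := j.2
    have hk := k.2
    simp only [edgeVec, Fin.ext_iff, Fin.val_castSucc, Fin.val_succ]
    rcases lt_or_gt_of_ne hne with h | h
    · by_cases h' : (k : ℕ) = j + 1
      · rw [h', hadj' _ (by omega)]
        simp [show (j : ℕ) ≠ j + 1 + 1 by omega]
      · rw [hfar _ _ (by omega) hk]
        simp [show (j : ℕ) ≠ k by omega, show (j : ℕ) ≠ k + 1 by omega,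
          show (j : ℕ) + 1 ≠ k by omega]
    · by_cases h' : (j : ℕ) = k + 1
      · rw [hA.apply, h', hadj' _ (by omega)]
        simp [show (k : ℕ) + 1 + 1 ≠ k by omega]
        ring
      · rw [hA.apply, hfar _ _ (by omega) hj]
        simp [show (j : ℕ) ≠ k by omega, show (j : ℕ) ≠ k + 1 by omega,
          show (j : ℕ) + 1 ≠ k by omega]
  · refine ⟨fun j => -∑ i ∈ Finset.range j, if h : i < m then g ⟨i, h⟩ else 0, fun k => ?_⟩
    simp [Finset.sum_range_succ]
  · by_contra! hcon
    have hstep : ∀ k : Fin m, k.castSucc ∈ S ↔ k.succ ∈ S := fun k => ⟨(hcon k).1, (hcon k).2⟩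
    have hall : ∀ j : Fin (m + 1), j ∈ S ↔ 0 ∈ S := by
      intro j
      induction j using Fin.induction with
      | zero => rfl
      | succ k ih => rw [← hstep k, ih]
    obtain ⟨i, hi⟩ := hS
    obtain ⟨j, hj⟩ := hS'
    exact hj ((hall j).2 ((hall i).1 hi))

/-- Large switched neighborhoods contain large switched cliques. -/
theorem exists_clique_of_neighbors {U : Type*} [Fintype U] {A : Matrix U U ℤ} (hA : A.IsSymm)
    (hd : ∀ u, A u u = 0) (hent : ∀ u w, A u w = -1 ∨ A u w = 0 ∨ A u w = 1) {lam : ℝ}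
    (hlam : lam ≤ 3) (hpos : ∀ x : U → ℝ, 0 ≤ x ⬝ᵥ shifted A lam *ᵥ x) (u : U) (k : ℕ)
    (N : Finset U) (hN : ∀ w ∈ N, A u w ≠ 0) (hcard : 24 * 8 ^ k ≤ N.card) :
    ∃ T ⊆ N, T.card = k ∧ ∀ v ∈ T, ∀ w ∈ T, v ≠ w → A v w = A u v * A u w := by
  have hsq : ∀ w, A u w ≠ 0 → A u w * A u w = 1 := by
    intro w hw
    rcases hent u w with h | h | h
    · rw [h]; rfl
    · exact absurd h hw
    · rw [h]; rfl
  induction k generalizing N with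
  | zero => exact ⟨∅, by simp, rfl, by simp⟩
  | succ k ih =>
    set B : U → U → ℤ := fun v w => A u v * A v w * A u w with hB
    have hu : u ∉ N := fun h => hN u h (hd u)
    set y : U → ℝ := fun w => if w ∈ N then (A u w : ℝ) else 0 with hy
    set n : ℝ := (N.card : ℝ) with hn
    have hoff : ∀ v w, v ≠ w → shifted A lam v w = A v w := by
      intro v w h
      simp [shifted, Matrix.one_apply_ne h]
    have hMy : (shifted A lam *ᵥ y) u = n := by
      simp only [Matrix.mulVec, dotProduct, hy, mul_ite, mul_zero, Finset.sum_ite_mem,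
        Finset.univ_inter]
      rw [Finset.sum_congr rfl fun w hw => ?_, Finset.sum_const, nsmul_eq_mul, mul_one]
      have huw : u ≠ w := by
        rintro rfl
        exact hu hw
      rw [hoff _ _ huw]
      exact_mod_cast hsq w (hN w hw)
    have hyM : y ⬝ᵥ (shifted A lam).col u = n := by
      rw [← hMy, dotProduct_comm]
      exact congrArg (· ⬝ᵥ y) (funext fun w => (shifted_isSymm hA lam).apply u w)
    have hyy : y ⬝ᵥ shifted A lam *ᵥ y = lam * n + ∑ v ∈ N, ∑ w ∈ N, (B v w : ℝ) := by
      have h1 : shifted A lam *ᵥ y = A.map (fun x => (x : ℝ)) *ᵥ y + lam • y := by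
        rw [shifted, Matrix.add_mulVec, Matrix.smul_mulVec, Matrix.one_mulVec]
      have h2 : y ⬝ᵥ y = n := by
        simp only [dotProduct, hy, ite_mul, zero_mul, mul_ite, mul_zero,
          ← ite_and, and_self, Finset.sum_ite_mem, Finset.univ_inter]
        rw [Finset.sum_congr rfl fun w hw => ?_, Finset.sum_const, nsmul_eq_mul, mul_one]
        exact_mod_cast hsq w (hN w hw)
      have h3 : y ⬝ᵥ A.map (fun x => (x : ℝ)) *ᵥ y = ∑ v ∈ N, ∑ w ∈ N, (B v w : ℝ) := by
        simp only [Matrix.mulVec, dotProduct, hy, ite_mul, zero_mul, mul_ite, mul_zero,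
          Finset.sum_ite_mem, Finset.univ_inter, Matrix.map_apply, hB]
        refine Finset.sum_congr rfl fun v _ => ?_
        rw [Finset.mul_sum]
        refine Finset.sum_congr rfl fun w _ => ?_
        push_cast
        ring
      rw [h1, dotProduct_add, dotProduct_smul, h2, h3, smul_eq_mul, add_comm]
    have h0 := hpos (Pi.single u (n / 2) - y)
    have huu : shifted A lam u u = lam := by simp [shifted, hd]
    have hform : (Pi.single u (n / 2) - y) ⬝ᵥ shifted A lam *ᵥ (Pi.single u (n / 2) - y) =
        n / 2 * (n / 2 * lam) - n / 2 * n - (n / 2 * n - y ⬝ᵥ shifted A lam *ᵥ y) := by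
      have hMe : shifted A lam *ᵥ Pi.single u (n / 2) = (n / 2) • (shifted A lam).col u := by
        ext w
        simp [mul_comm, div_eq_mul_inv]
      rw [Matrix.mulVec_sub, sub_dotProduct, dotProduct_sub, dotProduct_sub, single_dotProduct,
        single_dotProduct, hMy, hMe, Pi.smul_apply, Matrix.col_apply, huu, dotProduct_smul, hyM,
        smul_eq_mul, smul_eq_mul]
    rw [hform, hyy] at h0
    have hn0 : 0 ≤ n := Nat.cast_nonneg _
    have hsum : ∑ v ∈ N, ((n / 4 - 3 : ℝ)) ≤ ∑ v ∈ N, ∑ w ∈ N, (B v w : ℝ) := by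
      rw [Finset.sum_const, nsmul_eq_mul, ← hn]
      nlinarith [mul_nonneg hn0 (sub_nonneg.2 hlam),
        mul_nonneg (mul_nonneg hn0 hn0) (sub_nonneg.2 hlam)]
    have hNne : N.Nonempty := Finset.card_pos.1 (lt_of_lt_of_le (by positivity) hcard)
    obtain ⟨v, hv, hle⟩ := Finset.exists_le_of_sum_le hNne hsum
    set N' := N.filter fun w => B v w = 1 with hN'
    have hBle : ∑ w ∈ N, B v w ≤ N'.card := by
      rw [hN', Finset.card_filter]
      push_cast
      refine Finset.sum_le_sum fun w hw => ?_
      rcases hent u v with h | h | h <;> rcases hent v w with h' | h' | h' <;>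
        rcases hent u w with h'' | h'' | h'' <;> simp [hB, h, h', h'']
    have hcard' : 24 * 8 ^ k ≤ N'.card := by
      have h1 : (∑ w ∈ N, (B v w : ℝ)) ≤ N'.card := by exact_mod_cast hBle
      have h2 : n / 4 - 3 ≤ (N'.card : ℝ) := hle.trans h1
      have h3 : N.card ≤ 4 * N'.card + 12 := by
        have : n ≤ 4 * N'.card + 12 := by linarith
        rw [hn] at this
        exact_mod_cast this
      have h4 : 1 ≤ 8 ^ k := Nat.one_le_pow _ _ (by norm_num)
      rw [pow_succ] at hcard
      omega
    obtain ⟨T, hTN, hTk, hT⟩ := ih N' (fun w hw => hN w (Finset.mem_filter.1 hw).1) hcard'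
    have hvT : v ∉ T := by
      intro h
      have := (Finset.mem_filter.1 (hTN h)).2
      simp [hB, hd] at this
    have hvw : ∀ w ∈ T, A v w = A u v * A u w := by
      intro w hw
      obtain ⟨hwN, hBw⟩ := Finset.mem_filter.1 (hTN hw)
      have h1 := hsq v (hN v hv)
      have h2 := hsq w (hN w hwN)
      linear_combination (A u v * A u w) * hBw - A v w * A u w * A u w * h1 - A v w * h2
    refine ⟨insert v T, Finset.insert_subset hv fun w hw => (Finset.mem_filter.1 (hTN hw)).1,
      by rw [Finset.card_insert_of_notMem hvT, hTk], ?_⟩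
    intro x hx w hw hxw
    rcases Finset.mem_insert.1 hx with rfl | hxT
    · rcases Finset.mem_insert.1 hw with rfl | hwT
      · exact absurd rfl hxw
      · exact hvw w hwT
    · rcases Finset.mem_insert.1 hw with rfl | hwT
      · rw [hA.apply, hvw x hxT, mul_comm]
      · exact hT x hxT w hwT hxw

theorem SimpleGraph.Connected.dist_getVert_of_length_eq_dist {U : Type*} {G : SimpleGraph U}
    (hG : G.Connected) {u v : U} (p : G.Walk u v) (hp : p.length = G.dist u v) {i : ℕ}
    (hi : i ≤ p.length) : G.dist u (p.getVert i) = i := by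
  have h1 := G.dist_le (p.take i)
  have h2 := G.dist_le (p.drop i)
  have h3 : G.dist u v ≤ G.dist u (p.getVert i) + G.dist (p.getVert i) v := hG.dist_triangle
  rw [SimpleGraph.Walk.take_length] at h1
  rw [SimpleGraph.Walk.drop_length] at h2
  omega

theorem SimpleGraph.Connected.card_dist_le_le_pow {U : Type*} [Fintype U] {G : SimpleGraph U}
    (hG : G.Connected) {Δ : ℕ} (hΔ : ∀ v, (Finset.univ.filter (G.Adj v)).card ≤ Δ) (u : U)
    (d : ℕ) : (Finset.univ.filter fun w => G.dist u w ≤ d).card ≤ (Δ + 1) ^ d := by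
  induction d with
  | zero =>
    rw [pow_zero, Finset.card_le_one]
    intro x hx y hy
    simp only [Finset.mem_filter, Finset.mem_univ, true_and, Nat.le_zero,
      hG.dist_eq_zero_iff] at hx hy
    rw [← hx, ← hy]
  | succ d ih =>
    have hsub : (Finset.univ.filter fun w => G.dist u w ≤ d + 1) ⊆
        (Finset.univ.filter fun w => G.dist u w ≤ d).biUnion
          fun v => insert v (Finset.univ.filter (G.Adj v)) := by
      intro w hw
      simp only [Finset.mem_filter, Finset.mem_univ, true_and, Finset.mem_biUnion,
        Finset.mem_insert] at hw ⊢
      rcases Nat.le_succ_iff.1 hw with h | h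
      · exact ⟨w, h, Or.inl rfl⟩
      · obtain ⟨p, hp⟩ := hG.exists_walk_length_eq_dist u w
        refine ⟨p.getVert d, (hG.dist_getVert_of_length_eq_dist p hp (by omega)).le, Or.inr ?_⟩
        have hadj := p.adj_getVert_succ (i := d) (by omega)
        rwa [show d + 1 = p.length by omega, p.getVert_length] at hadj
    refine (Finset.card_le_card hsub).trans ((Finset.card_biUnion_le_card_mul _ _ (Δ + 1)
      fun v _ => (Finset.card_insert_le _ _).trans (Nat.succ_le_succ (hΔ v))).trans ?_)
    rw [pow_succ]
    exact Nat.mul_le_mul_right _ ih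

theorem hasTreeRep_of_card_gt {U : Type*} [Fintype U] {A : Matrix U U ℤ} (hA : A.IsSymm)
    (hd : ∀ u, A u u = 0) (hent : ∀ u w, A u w = -1 ∨ A u w = 0 ∨ A u w = 1) {G : SimpleGraph U}
    (hadj : ∀ u w, G.Adj u w ↔ A u w ≠ 0) (hG : G.Connected) {lam : ℝ}
    (hlam : lam ≤ 3) (hpos : ∀ x : U → ℝ, 0 ≤ x ⬝ᵥ shifted A lam *ᵥ x) (K : ℕ)
    (hcard : (24 * 8 ^ K + 1) ^ K < Fintype.card U) : HasTreeRep A (K + 1) := by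
  by_cases hΔ : ∀ v, (Finset.univ.filter (G.Adj v)).card ≤ 24 * 8 ^ K
  · obtain ⟨u⟩ := hG.nonempty
    have hfar : ∃ w, K < G.dist u w := by
      by_contra! h
      have := hG.card_dist_le_le_pow hΔ u K
      rw [Finset.filter_true_of_mem fun w _ => h w, Finset.card_univ] at this
      omega
    obtain ⟨w, hw⟩ := hfar
    obtain ⟨p, hp⟩ := hG.exists_walk_length_eq_dist u w
    have hdist : ∀ i < K, G.dist u (p.getVert i) = i :=
      fun i hi => hG.dist_getVert_of_length_eq_dist p hp (by omega)
    refine hasTreeRep_of_path hA p.getVert (fun i hi j hj h => ?_) (fun i hi => ?_)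
      fun i j hij hj => ?_
    · rw [← hdist i hi, ← hdist j hj, h]
    · have h0 := (hadj _ _).1 (p.adj_getVert_succ (i := i) (by omega))
      rcases hent (p.getVert i) (p.getVert (i + 1)) with h | h | h
      · exact Or.inr h
      · exact absurd h h0
      · exact Or.inl h
    · by_contra h
      have h1 := SimpleGraph.dist_eq_one_iff_adj.2 ((hadj _ _).2 h)
      have h2 : G.dist u (p.getVert j) ≤ G.dist u (p.getVert i) +
        G.dist (p.getVert i) (p.getVert j) := hG.dist_triangle
      rw [hdist i (by omega), hdist j hj, h1] at h2
      omega
  · push Not at hΔ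
    obtain ⟨u, hu⟩ := hΔ
    have hN : ∀ w ∈ Finset.univ.filter (G.Adj u), A u w ≠ 0 :=
      fun w hw => (hadj u w).1 (Finset.mem_filter.1 hw).2
    obtain ⟨T, hT, hTK, hTA⟩ := exists_clique_of_neighbors hA hd hent hlam hpos u K _ hN hu.le
    rw [← hTK]
    refine hasTreeRep_of_clique T (A u) (fun w hw => ?_) hTA
    rcases hent u w with h | h | h
    · exact Or.inr h
    · exact absurd h (hN w (hT hw))
    · exact Or.inl h

theorem HasTreeRep.exists_maximal {U : Type*} [Fintype U] {A : Matrix U U ℤ} {K : ℕ}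
    (h : HasTreeRep A K) : ∃ n ≥ K, HasTreeRep A n ∧ ¬ HasTreeRep A (n + 1) := by
  by_contra! hcon
  have hall : ∀ m, HasTreeRep A (K + m) := by
    intro m
    induction m with
    | zero => exact h
    | succ m ih => exact hcon _ (Nat.le_add_right _ _) ih
  obtain ⟨ι, V, _, _, ⟨F⟩, hV⟩ := hall (Fintype.card U + 2)
  have h1 := F.card_eq
  have h2 := Fintype.card_le_of_injective _ F.inj
  omega

/-- Beyond a certain order, the shift by `2` of a connected signed graph is a Gram matrix as soon
as the shift by some `lam < lamStar` is positive semidefinite. -/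
theorem exists_forall_exists_gram {t lamStar lam : ℝ} (ht : 1 < t) (ht6 : t ^ 6 = t ^ 2 + 1)
    (hstar : lamStar = t + t⁻¹) (h2 : 2 < lam) (h3 : lam ≤ 3) (hlt : lam < lamStar) :
    ∃ N : ℕ, ∀ {U : Type} [Fintype U] {A : Matrix U U ℤ} {G : SimpleGraph U}, A.IsSymm →
      (∀ u, A u u = 0) → (∀ u w, A u w = -1 ∨ A u w = 0 ∨ A u w = 1) →
      (∀ u w, G.Adj u w ↔ A u w ≠ 0) → G.Connected →
      (∀ x : U → ℝ, 0 ≤ x ⬝ᵥ shifted A lam *ᵥ x) → N < Fintype.card U →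
      ∃ (V : Type) (_ : Fintype V) (ρ : U → V → ℤ), ∀ u w,
        (A u w + if u = w then 2 else 0) = ∑ i, ρ u i * ρ w i := by
  obtain ⟨N, hN⟩ := exists_isStiff_of_card_ge ht ht6 hstar h2.le hlt
  refine ⟨(24 * 8 ^ (N + 7) + 1) ^ (N + 7), ?_⟩
  intro U _ A G hA hd hent hadj hG hpos hcard
  obtain ⟨n, hn, ⟨ι, V, _, _, ⟨F⟩, hV⟩, hmax⟩ :=
    (hasTreeRep_of_card_gt hA hd hent hadj hG h3 hpos (N + 7) hcard).exists_maximal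
  have hconn : ∀ S : Set U, S.Nonempty → Sᶜ.Nonempty → ∃ u ∈ S, ∃ w ∉ S, A u w ≠ 0 := by
    rintro S ⟨u, hu⟩ ⟨w, hw⟩
    obtain ⟨p⟩ := hG.preconnected u w
    obtain ⟨d, -, h1, h2⟩ := p.exists_boundary_dart S hu hw
    exact ⟨_, h1, _, h2, (hadj _ _).1 d.adj⟩
  have hr : 1 / (lamStar - 2) ≤ 1 / (lam - 2) :=
    one_div_le_one_div_of_le (by linarith) (by linarith)
  have hr0 : 0 ≤ 1 / (lamStar - 2) := one_div_nonneg.2 (by linarith)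
  obtain ⟨ρ, hρ⟩ := F.exists_gram_of_maximal hA hd hent hconn h2 hr0 hr hpos
    (hN F.a F.b F.cuts (by omega)) (by omega)
    fun ⟨F'⟩ => hmax ⟨_, _, inferInstance, inferInstance, ⟨F'⟩, by rw [Fintype.card_option, hV]⟩
  exact ⟨V, inferInstance, ρ, hρ⟩

theorem IsEigenvalue.minEig_le {V : Type*} [Fintype V] {A : Matrix V V ℝ} {μ : ℝ}
    (h : IsEigenvalue A μ) : minEig A ≤ μ := by
  have hfin : {μ : ℝ | IsEigenvalue A μ}.Finite := by
    refine (Module.End.finite_hasEigenvalue (Matrix.toLin' A)).subset ?_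
    rintro ν ⟨v, hv, hAv⟩
    exact Module.End.hasEigenvalue_of_hasEigenvector
      (Module.End.hasEigenvector_iff.2 ⟨Module.End.mem_eigenspace_iff.2 hAv, hv⟩)
  exact csInf_le hfin.bddBelow h

theorem exists_isEigenvalue_lt_of_minEig_lt {V : Type*} [Fintype V] {A : Matrix V V ℝ} {c : ℝ}
    (hc : c ≤ 0) (h : minEig A < c) : ∃ μ < c, IsEigenvalue A μ := by
  have hne : {μ : ℝ | IsEigenvalue A μ}.Nonempty := by
    by_contra hemp
    rw [minEig, Set.not_nonempty_iff_eq_empty.1 hemp, Real.sInf_empty] at h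
    exact absurd h hc.not_gt
  obtain ⟨μ, hμ, hlt⟩ := exists_lt_of_csInf_lt hne h
  exact ⟨μ, hlt, hμ⟩

theorem dotProduct_shift_mulVec_nonneg_of_le_minEig {V : Type*} [Fintype V] [DecidableEq V]
    {A : Matrix V V ℝ} (hA : A.IsSymm) {lam : ℝ} (h : -lam ≤ minEig A) (x : V → ℝ) :
    0 ≤ x ⬝ᵥ (A + lam • (1 : Matrix V V ℝ)) *ᵥ x := by
  have hB : (A + lam • (1 : Matrix V V ℝ)).IsHermitian := by
    rw [Matrix.IsHermitian, Matrix.conjTranspose_eq_transpose_of_trivial, Matrix.transpose_add,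
      Matrix.transpose_smul, Matrix.transpose_one, hA.eq]
  have hpsd : (A + lam • (1 : Matrix V V ℝ)).PosSemidef := by
    rw [hB.posSemidef_iff_eigenvalues_nonneg]
    intro j
    have hj := hB.mulVec_eigenvectorBasis j
    rw [Matrix.add_mulVec, Matrix.smul_mulVec, Matrix.one_mulVec, ← eq_sub_iff_add_eq,
      ← sub_smul] at hj
    have hne : (hB.eigenvectorBasis j).ofLp ≠ 0 := by
      simpa using hB.eigenvectorBasis.orthonormal.ne_zero j
    have hle := IsEigenvalue.minEig_le ⟨_, hne, hj⟩
    change 0 ≤ hB.eigenvalues j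
    linarith
  simpa using hpsd.dotProduct_mulVec_nonneg x

theorem not_isEigenvalue_of_gram {U V : Type*} [Fintype U] [DecidableEq U] [Fintype V]
    {M : Matrix U U ℝ} (ρ : U → V → ℝ) (hρ : ∀ u w, (M u w + if u = w then 2 else 0) = ∑ i, ρ u i * ρ w i)
    {μ : ℝ} (hμ : μ < -2) : ¬ IsEigenvalue M μ := by
  rintro ⟨v, hv, hMv⟩
  have hvv : 0 < v ⬝ᵥ v := by
    simpa using Matrix.dotProduct_star_self_pos_iff.2 hv
  have hM : M + (2 : ℝ) • (1 : Matrix U U ℝ) = Matrix.of ρ * (Matrix.of ρ)ᵀ := by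
    ext u w
    rw [Matrix.mul_apply]
    simpa [Matrix.one_apply] using hρ u w
  have h1 : v ⬝ᵥ (M + (2 : ℝ) • (1 : Matrix U U ℝ)) *ᵥ v = (μ + 2) * (v ⬝ᵥ v) := by
    rw [Matrix.add_mulVec, hMv, Matrix.smul_mulVec, Matrix.one_mulVec, ← add_smul,
      dotProduct_smul, smul_eq_mul]
  have h2 : 0 ≤ v ⬝ᵥ (M + (2 : ℝ) • (1 : Matrix U U ℝ)) *ᵥ v := by
    rw [hM]
    have := (Matrix.posSemidef_self_mul_conjTranspose (Matrix.of ρ)).dotProduct_mulVec_nonneg v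
    simpa using this
  nlinarith

/-- For `2 ≤ λ < λ*` there is a uniform bound on the number of vertices of connected signed
graphs whose smallest eigenvalue lies in `[-λ, -2)`. -/
theorem finitely_many_connected_signed_graphs_in_window
    (βs lamStar : ℝ) (hβs : βs ^ 3 = βs + 1)
    (hstar : lamStar = Real.sqrt βs + (Real.sqrt βs)⁻¹)
    (lam : ℝ) (h2 : 2 ≤ lam) (hlt : lam < lamStar) :
    ∃ N : ℕ, ∀ (n : ℕ) (G : SignedGraph n), G.toSimple.Connected →
      -lam ≤ minEig G.mat → minEig G.mat < -2 → n ≤ N := by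
  rcases h2.eq_or_lt with rfl | h2
  · exact ⟨0, fun n G _ h h' => absurd h h'.not_ge⟩
  have hβ1 : 1 < βs := by
    by_contra! h
    rcases le_or_gt 0 βs with h0 | h0
    · nlinarith [mul_nonneg h0 h0, mul_le_mul_of_nonneg_left h (mul_nonneg h0 h0)]
    · nlinarith [sq_nonneg (βs + 1), sq_nonneg βs, sq_nonneg (2 * βs + 1)]
  have hβ2 : βs < 2 := by
    by_contra! h
    nlinarith [mul_nonneg (sub_nonneg.2 h) (sq_nonneg βs)]
  set t := Real.sqrt βs with ht
  have htsq : t ^ 2 = βs := Real.sq_sqrt (by linarith)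
  have ht0 : 0 ≤ t := Real.sqrt_nonneg _
  have ht1 : 1 < t := by nlinarith
  have ht2 : t < 2 := by nlinarith
  have ht6 : t ^ 6 = t ^ 2 + 1 := by
    rw [htsq, ← hβs, ← htsq]
    ring
  have hlam3 : lam ≤ 3 := by
    have : t⁻¹ ≤ 1 := inv_le_one_of_one_le₀ ht1.le
    linarith
  obtain ⟨N, hN⟩ := exists_forall_exists_gram ht1 ht6 hstar h2 hlam3 hlt
  refine ⟨N, fun n G hG hle hlt => ?_⟩
  by_contra! hn
  have hent : ∀ u w, ∃ a : ℤ, (a : ℝ) = G.mat u w ∧ (a = -1 ∨ a = 0 ∨ a = 1) := by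
    intro u w
    rcases G.entries u w with h | h | h
    · exact ⟨-1, by simp [h]⟩
    · exact ⟨0, by simp [h]⟩
    · exact ⟨1, by simp [h]⟩
  choose A hAmat hAent using hent
  have hA : ∀ u w, A u w = A w u := by
    intro u w
    have : (A u w : ℝ) = A w u := by rw [hAmat, hAmat, G.isSymm.apply]
    exact_mod_cast this
  have hd : ∀ u, A u u = 0 := by
    intro u
    have : (A u u : ℝ) = 0 := by rw [hAmat, G.diag_zero]
    exact_mod_cast this
  have hadj : ∀ u w, G.toSimple.Adj u w ↔ A u w ≠ 0 := by
    intro u w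
    rw [SignedGraph.toSimple, SimpleGraph.fromRel_adj, ← hAmat, ← hAmat, hA w u, or_self,
      Int.cast_ne_zero, and_iff_right_iff_imp]
    rintro h rfl
    exact h (hd u)
  have hmap : (Matrix.of A).map (fun x => (x : ℝ)) = G.mat := Matrix.ext hAmat
  obtain ⟨V, _, ρ, hρ⟩ := hN (A := Matrix.of A) (Matrix.IsSymm.ext fun u w => hA w u) hd hAent
    hadj hG (fun x => by
      rw [shifted, hmap]
      convert dotProduct_shift_mulVec_nonneg_of_le_minEig G.isSymm hle x) (by simpa using hn)
  obtain ⟨μ, hμ, hev⟩ := exists_isEigenvalue_lt_of_minEig_lt (by norm_num) hlt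
  refine not_isEigenvalue_of_gram (fun u i => (ρ u i : ℝ)) (fun u w => ?_) hμ hev
  have h := congrArg (Int.cast : ℤ → ℝ) (hρ u w)
  rw [← hAmat]
  push_cast at h
  exact h
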